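/- arXiv:2508.13289 — 2 statements merged into one kernel-verified Lean document; each statement's English description precedes it below -/
import Mathlib

section
/- Let n ≥ 2. (1) If X is an n-correct set and B ∈ X, then there are at most n special triplets of X having B as a common node; and if there are exactly n such triplets, then X has exactly n maximal lines not passing through B. (2) If n ≥ 3 and X is a GC_n set, then there are at most n used 2-node lines of X with a fixed common node B ∈ X (2-node lines through B each used by some node of X); and if there are exactly n such lines, then X has exactly n+1 maximal lines, of which n do not pass through B and one passes through B, and X is a Carnicer–Gasca set of degree n. -/
open MvPolynomial Finset
open scoped Classical BigOperators

noncomputable section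

/-- Points of the plane. -/
abbrev Pt : Type := Fin 2 → ℝ

/-- Bivariate real polynomials. -/
abbrev Poly2 : Type := MvPolynomial (Fin 2) ℝ

/-- `N = dim Π_n = (n+1)(n+2)/2`. -/
def Nn (n : ℕ) : ℕ := (n + 1) * (n + 2) / 2

/-- `X` is an `n`-correct set of nodes: it has `N` nodes and the only polynomial of total
degree at most `n` vanishing at all of them is the zero polynomial. -/
def IsNCorrect (n : ℕ) (X : Finset Pt) : Prop :=
  X.card = Nn n ∧
  ∀ p : Poly2, p.totalDegree ≤ n → (∀ P ∈ X, eval P p = 0) → p = 0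

/-- A line: a (nonzero) polynomial of total degree exactly 1. -/
def IsLine (ℓ : Poly2) : Prop := ℓ.totalDegree = 1

/-- The zero set of a polynomial, as a subset of the plane. -/
def zeroSet (q : Poly2) : Set Pt := {P : Pt | eval P q = 0}

/-- `X ∩ q` : the nodes of `X` lying on the curve `q`. -/
def zerosIn (X : Finset Pt) (q : Poly2) : Finset Pt := X.filter fun P => eval P q = 0

/-- `X \ q` : the nodes of `X` not lying on the curve `q`. -/
def nonzerosIn (X : Finset Pt) (q : Poly2) : Finset Pt := X.filter fun P => eval P q ≠ 0

/-- `ℓ` is a maximal line for (an `n`-correct set) `X`: a line passing through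
exactly `n+1` nodes. -/
def IsMaximalLine (n : ℕ) (X : Finset Pt) (ℓ : Poly2) : Prop :=
  IsLine ℓ ∧ (zerosIn X ℓ).card = n + 1

/-- The collection of maximal lines of `X` (as subsets of the plane). -/
def maximalLines (n : ℕ) (X : Finset Pt) : Set (Set Pt) :=
  {Z : Set Pt | ∃ ℓ : Poly2, IsMaximalLine n X ℓ ∧ Z = zeroSet ℓ}

/-- `p` is the `n`-fundamental polynomial of the node `A` of `X`. -/
def IsFund (n : ℕ) (X : Finset Pt) (A : Pt) (p : Poly2) : Prop :=
  p.totalDegree ≤ n ∧ eval A p = 1 ∧ ∀ P ∈ X, P ≠ A → eval P p = 0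

/-- The node `A` of `X` uses the curve `q`: `q` divides the fundamental polynomial of `A`. -/
def Uses (n : ℕ) (X : Finset Pt) (A : Pt) (q : Poly2) : Prop :=
  ∃ p : Poly2, IsFund n X A p ∧ q ∣ p

/-- `d(n,k) = k(2n+3-k)/2`. -/
def d (n k : ℕ) : ℕ := k * (2 * n + 3 - k) / 2

/-- `q` is a maximal curve of degree `k` for `X`: it passes through exactly `d(n,k)` nodes. -/
def IsMaximalCurve (n k : ℕ) (X : Finset Pt) (q : Poly2) : Prop :=
  q.totalDegree = k ∧ (zerosIn X q).card = d n k

/-- `{A,B,C}` is a special triplet of the `n`-correct set `X` : there is a maximal curve `f`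
of degree `n-1` with `X \ f = {A,B,C}`. -/
def IsSpecialTriplet (n : ℕ) (X : Finset Pt) (A B C : Pt) : Prop :=
  A ∈ X ∧ B ∈ X ∧ C ∈ X ∧ A ≠ B ∧ A ≠ C ∧ B ≠ C ∧
  ∃ f : Poly2, IsMaximalCurve n (n - 1) X f ∧ nonzerosIn X f = {A, B, C}

/-- `X` is a `GC_n` set: an `n`-correct set in which every fundamental polynomial is a
product of `n` linear factors. -/
def IsGC (n : ℕ) (X : Finset Pt) : Prop :=
  IsNCorrect n X ∧
  ∀ A ∈ X, ∃ p : Poly2, IsFund n X A p ∧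
    ∃ g : Fin n → Poly2, (∀ i, (g i).totalDegree = 1) ∧ p = ∏ i, g i

/-- `ℓ` is a line passing through the points `P` and `Q` (in particular, `ℓ_{PQ}` when
`P ≠ Q`). -/
def IsLineThrough (ℓ : Poly2) (P Q : Pt) : Prop :=
  IsLine ℓ ∧ eval P ℓ = 0 ∧ eval Q ℓ = 0

/-- `ℓ` is a `2`-node line of `X` passing through exactly the two nodes `A` and `B`. -/
def IsTwoNodeLineOf (X : Finset Pt) (ℓ : Poly2) (A B : Pt) : Prop :=
  IsLine ℓ ∧ A ≠ B ∧ zerosIn X ℓ = {A, B}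

/-- `Y` is an `n`-independent set: every point has an `n`-fundamental polynomial. -/
def IsNIndependent (n : ℕ) (Y : Finset Pt) : Prop :=
  ∀ A ∈ Y, ∃ p : Poly2, p.totalDegree ≤ n ∧ eval A p ≠ 0 ∧
    ∀ P ∈ Y, P ≠ A → eval P p = 0

/-- A family of lines is in general position: no two parallel (or equal) — i.e. any two of
them meet in a unique point — and no three concurrent. -/
def GenPos {m : ℕ} (ℓ : Fin m → Poly2) : Prop :=
  (∀ i, IsLine (ℓ i)) ∧
  (∀ i j, i ≠ j → ∃! P : Pt, eval P (ℓ i) = 0 ∧ eval P (ℓ j) = 0) ∧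
  (∀ i j k, i ≠ j → i ≠ k → j ≠ k →
    ¬∃ P : Pt, eval P (ℓ i) = 0 ∧ eval P (ℓ j) = 0 ∧ eval P (ℓ k) = 0)

/-- `X` is a Chung–Yao set of degree `n`: the set of pairwise intersection points of `n+2`
lines in general position. -/
def IsChungYao (n : ℕ) (X : Finset Pt) : Prop :=
  ∃ ℓ : Fin (n + 2) → Poly2, GenPos ℓ ∧
    (↑X : Set Pt) = {P : Pt | ∃ i j, i ≠ j ∧ eval P (ℓ i) = 0 ∧ eval P (ℓ j) = 0}

/-- `X` is a Carnicer–Gasca set of degree `n`: the pairwise intersection points of `n+1`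
lines in general position together with one extra point `A i` on each line `ℓ i`, the `A i`
lying on no other line of the family and not all collinear. -/
def IsCarnicerGasca (n : ℕ) (X : Finset Pt) : Prop :=
  ∃ (ℓ : Fin (n + 1) → Poly2) (A : Fin (n + 1) → Pt), GenPos ℓ ∧
    (∀ i j, eval (A i) (ℓ j) = 0 ↔ j = i) ∧
    (¬∃ L : Poly2, IsLine L ∧ ∀ i, eval (A i) L = 0) ∧
    (↑X : Set Pt) =
      {P : Pt | ∃ i j, i ≠ j ∧ eval P (ℓ i) = 0 ∧ eval P (ℓ j) = 0} ∪ Set.range A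

/-! ### Lines and divisibility -/

lemma exists_eq_affine {p : Poly2} (hp : p.totalDegree ≤ 1) :
    ∃ a b c : ℝ, p = C a * X 0 + C b * X 1 + C c := by
  refine ⟨coeff (Finsupp.single 0 1) p, coeff (Finsupp.single 1 1) p, coeff 0 p, ?_⟩
  ext m
  have hz : ∀ i : Fin 2, (0 : Fin 2 →₀ ℕ) ≠ Finsupp.single i 1 := fun i =>
    (Finsupp.single_ne_zero.2 one_ne_zero).symm
  by_cases hm : m 0 + m 1 ≤ 1
  · have hcases : m = 0 ∨ m = Finsupp.single 0 1 ∨ m = Finsupp.single 1 1 := by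
      have : (m 0 = 0 ∧ m 1 = 0) ∨ (m 0 = 1 ∧ m 1 = 0) ∨ (m 0 = 0 ∧ m 1 = 1) := by omega
      rcases this with h | h | h
      · left; ext i; fin_cases i <;> simp [h]
      · right; left; ext i; fin_cases i <;> simp [h]
      · right; right; ext i; fin_cases i <;> simp [h]
    rcases hcases with rfl | rfl | rfl <;>
      simp [coeff_C_mul, coeff_X, coeff_C, Finsupp.single_left_inj, hz]
  · have hdeg : p.totalDegree < ∑ i ∈ m.support, m i := by
      have : ∑ i ∈ m.support, m i = m 0 + m 1 := by
        rw [← Fin.sum_univ_two]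
        exact Finset.sum_subset (Finset.subset_univ _) (by simp)
      omega
    rw [coeff_eq_zero_of_totalDegree_lt hdeg]
    have h0 : m ≠ 0 := by rintro rfl; simp at hm
    have h1 : Finsupp.single 0 1 ≠ m := by rintro rfl; simp at hm
    have h2 : Finsupp.single 1 1 ≠ m := by rintro rfl; simp at hm
    simp [coeff_C_mul, coeff_X, coeff_C, h0.symm, h1, h2]

lemma IsLine.ne_zero {ℓ : Poly2} (h : IsLine ℓ) : ℓ ≠ 0 := by
  rintro rfl; simp [IsLine] at h

lemma IsLine.prime {ℓ : Poly2} (h : IsLine ℓ) : Prime ℓ := by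
  refine (irreducible_of_totalDegree_eq_one h fun x hx => ?_).prime
  refine isUnit_iff_ne_zero.2 ?_
  rintro rfl
  exact h.ne_zero (by ext m; simpa using hx m)

/-- A polynomial of degree at most `k` vanishing at more than `k` points of a line is
divisible by the line. -/
lemma IsLine.dvd_of_card {ℓ p : Poly2} {k : ℕ} (hℓ : IsLine ℓ) (hp : p.totalDegree ≤ k)
    (s : Finset Pt) (hs : k < s.card) (hsℓ : ∀ P ∈ s, eval P ℓ = 0)
    (hsp : ∀ P ∈ s, eval P p = 0) : ℓ ∣ p := by
  obtain ⟨P₀, hP₀⟩ : s.Nonempty := Finset.card_pos.1 (by omega)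
  obtain ⟨a, b, c, hform⟩ := exists_eq_affine hℓ.le
  have hev : ∀ P : Pt, eval P ℓ = a * P 0 + b * P 1 + c := fun P => by simp [hform]
  have hab : a ^ 2 + b ^ 2 ≠ 0 := by
    intro h
    have ha : a = 0 := by nlinarith [sq_nonneg a, sq_nonneg b]
    have hb : b = 0 := by nlinarith [sq_nonneg a, sq_nonneg b]
    rw [IsLine, hform, ha, hb] at hℓ
    simp at hℓ
  let v : Fin 2 → ℝ := ![b, -a]
  let φ : Poly2 →ₐ[ℝ] Polynomial ℝ :=
    aeval fun i => Polynomial.C (P₀ i) + Polynomial.C (v i) * Polynomial.X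
  let τ : Pt → ℝ := fun P => (b * (P 0 - P₀ 0) - a * (P 1 - P₀ 1)) / (a ^ 2 + b ^ 2)
  have hpt : ∀ P : Pt, eval P ℓ = 0 → ∀ i, P₀ i + v i * τ P = P i := by
    intro P hP i
    have h1 := hev P
    have h2 := hev P₀
    rw [hP] at h1
    rw [hsℓ P₀ hP₀] at h2
    fin_cases i
    · simp only [v, τ, Fin.zero_eta, Matrix.cons_val_zero]
      field_simp
      linear_combination a * h1 - a * h2
    · simp only [v, τ, Fin.mk_one, Matrix.cons_val_one, Matrix.cons_val_fin_one]
      field_simp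
      linear_combination b * h1 - b * h2
  have hφev : ∀ P : Pt, eval P ℓ = 0 → ∀ q : Poly2, (φ q).eval (τ P) = eval P q := by
    intro P hP q
    have : (Polynomial.aeval (τ P)).comp φ = aeval P := by
      ext i
      simpa [φ] using hpt P hP i
    have := DFunLike.congr_fun this q
    simpa [Polynomial.coe_aeval_eq_eval, aeval_eq_eval] using this
  have hφp : φ p = 0 := by
    refine Polynomial.eq_zero_of_natDegree_lt_card_of_eval_eq_zero' _ (s.image τ) ?_ ?_
    · intro t ht
      obtain ⟨P, hP, rfl⟩ := Finset.mem_image.1 ht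
      rw [hφev P (hsℓ P hP), hsp P hP]
    · rw [Finset.card_image_of_injOn]
      · refine lt_of_le_of_lt (aeval_natDegree_le (n := 1) p hp _ fun i => ?_) (by simpa using hs)
        compute_degree
      · intro P hP Q hQ h
        ext i
        rw [← hpt P (hsℓ P hP) i, ← hpt Q (hsℓ Q hQ) i, h]
  let T : Poly2 := C (a ^ 2 + b ^ 2)⁻¹ * (C b * (X 0 - C (P₀ 0)) - C a * (X 1 - C (P₀ 1)))
  rw [← Ideal.Quotient.eq_zero_iff_dvd]
  let π : Poly2 →ₐ[ℝ] Poly2 ⧸ Ideal.span {ℓ} := Ideal.Quotient.mkₐ ℝ _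
  have hcomp : π.comp ((Polynomial.aeval T).comp φ) = π := by
    ext i
    rw [← sub_eq_zero]
    have hc : c = -(a * P₀ 0 + b * P₀ 1) := by linarith [hev P₀, hsℓ P₀ hP₀]
    suffices h : ℓ ∣ (Polynomial.aeval T) (φ (X i)) - X i by
      rw [← Ideal.Quotient.eq_zero_iff_dvd] at h
      simpa [π] using h
    have hC : (C (a ^ 2 + b ^ 2)⁻¹ * (C a ^ 2 + C b ^ 2) : Poly2) = 1 := by
      rw [← C_pow, ← C_pow, ← C_add, ← C_mul, inv_mul_cancel₀ hab, C_1]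
    rw [hform, hc]
    fin_cases i
    · refine ⟨-C (a ^ 2 + b ^ 2)⁻¹ * C a, ?_⟩
      simp [φ, v, T, MvPolynomial.algebraMap_eq]
      linear_combination (X 0 - C (P₀ 0)) * hC
    · refine ⟨-C (a ^ 2 + b ^ 2)⁻¹ * C b, ?_⟩
      simp [φ, v, T, MvPolynomial.algebraMap_eq]
      linear_combination (X 1 - C (P₀ 1)) * hC
  have := DFunLike.congr_fun hcomp p
  simp only [AlgHom.comp_apply, hφp, map_zero] at this
  exact this.symm

lemma IsLine.dvd_of_two {ℓ p : Poly2} (hℓ : IsLine ℓ) (hp : p.totalDegree ≤ 1) {P Q : Pt}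
    (hPQ : P ≠ Q) (hP : eval P ℓ = 0) (hQ : eval Q ℓ = 0) (hP' : eval P p = 0)
    (hQ' : eval Q p = 0) : ℓ ∣ p :=
  hℓ.dvd_of_card hp {P, Q} (by rw [Finset.card_pair hPQ]; omega) (by simp [hP, hQ])
    (by simp [hP', hQ'])

lemma eval_eq_zero_of_dvd {p q : Poly2} (h : p ∣ q) {P : Pt} (hP : eval P p = 0) :
    eval P q = 0 := by
  obtain ⟨r, rfl⟩ := h
  simp [hP]

lemma IsLine.dvd_symm {ℓ m : Poly2} (hℓ : IsLine ℓ) (hm : IsLine m) (h : ℓ ∣ m) : m ∣ ℓ :=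
  ((hℓ.prime.irreducible.associated_of_dvd hm.prime.irreducible h).symm).dvd

/-- The line through two points. -/
def lineThrough (P Q : Pt) : Poly2 :=
  C (Q 1 - P 1) * X 0 + C (P 0 - Q 0) * X 1 + C ((Q 0 - P 0) * P 1 - (Q 1 - P 1) * P 0)

lemma eval_lineThrough_left (P Q : Pt) : eval P (lineThrough P Q) = 0 := by
  simp [lineThrough]; ring

lemma eval_lineThrough_right (P Q : Pt) : eval Q (lineThrough P Q) = 0 := by
  simp [lineThrough]; ring

lemma isLine_lineThrough {P Q : Pt} (h : P ≠ Q) : IsLine (lineThrough P Q) := by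
  have hle : (lineThrough P Q).totalDegree ≤ 1 := by
    have hX : ∀ (a : ℝ) (i : Fin 2), (C a * X i : Poly2).totalDegree ≤ 1 := fun a i =>
      (totalDegree_mul _ _).trans (by simp)
    refine (totalDegree_add _ _).trans (max_le ((totalDegree_add _ _).trans
      (max_le (hX _ _) (hX _ _))) (by rw [totalDegree_C]; omega))
  refine le_antisymm hle (Nat.one_le_iff_ne_zero.2 fun h0 => h ?_)
  rw [totalDegree_eq_zero_iff_eq_C] at h0
  have hconst : ∀ R S : Pt, eval R (lineThrough P Q) = eval S (lineThrough P Q) := by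
    intro R S
    rw [h0]; simp
  have e1 := hconst ![0, 0] ![1, 0]
  have e2 := hconst ![0, 0] ![0, 1]
  simp [lineThrough] at e1 e2
  ext i
  fin_cases i
  · simp only [Fin.zero_eta]; linarith
  · simp only [Fin.mk_one]; linarith

lemma totalDegree_mul_le {p q : Poly2} {a b : ℕ} (hp : p.totalDegree ≤ a)
    (hq : q.totalDegree ≤ b) : (p * q).totalDegree ≤ a + b :=
  (totalDegree_mul _ _).trans (add_le_add hp hq)

lemma totalDegree_finset_prod_lines {ι : Type*} (s : Finset ι) (e : ι → Poly2)
    (he : ∀ i ∈ s, IsLine (e i)) : (∏ i ∈ s, e i).totalDegree = s.card := by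
  induction s using Finset.induction_on with
  | empty => simp
  | insert a s ha ih =>
    rw [Finset.prod_insert ha, totalDegree_mul_of_isDomain (he a (by simp)).ne_zero
      (Finset.prod_ne_zero_iff.2 fun i hi => (he i (by simp [hi])).ne_zero),
      ih fun i hi => he i (by simp [hi]), Finset.card_insert_of_notMem ha, he a (by simp)]
    ring

/-! ### Triplets and factorizations of the fundamental polynomial of the common node -/

/-- The fundamental polynomial of `B` is the product of `f` and the line `e` through `A` and
`C`, where `f` misses exactly the nodes `A`, `B` and `C`. -/
structure IsTripletFactor (n : ℕ) (X : Finset Pt) (B A C : Pt) (e f : Poly2) : Prop where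
  memA : A ∈ X
  memC : C ∈ X
  A_ne_B : A ≠ B
  C_ne_B : C ≠ B
  A_ne_C : A ≠ C
  line : IsLine e
  evalA : eval A e = 0
  evalC : eval C e = 0
  fund : IsFund n X B (f * e)
  eval_ne : ∀ P ∈ X, eval P f ≠ 0 ↔ P = A ∨ P = B ∨ P = C

lemma IsFund.unique {n : ℕ} {X : Finset Pt} (hX : IsNCorrect n X) {B : Pt} {p q : Poly2}
    (hp : IsFund n X B p) (hq : IsFund n X B q) : p = q := by
  rw [← sub_eq_zero]
  refine hX.2 _ ((totalDegree_sub _ _).trans (max_le hp.1 hq.1)) fun P hP => ?_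
  by_cases h : P = B
  · simp [h, hp.2.1, hq.2.1]
  · simp [hp.2.2 P hP h, hq.2.2 P hP h]

/-- A nonzero polynomial of degree at most `n - 1` missing at most three nodes. -/
lemma exists_isTripletFactor {n : ℕ} (hn : 2 ≤ n) {X : Finset Pt} (hX : IsNCorrect n X)
    {A B C : Pt} (hA : A ∈ X) (hB : B ∈ X) (hC : C ∈ X) (hAB : A ≠ B) (hCB : C ≠ B)
    (hAC : A ≠ C) {f : Poly2} (hf0 : f ≠ 0) (hf : f.totalDegree ≤ n - 1)
    (hfX : ∀ P ∈ X, P ≠ A → P ≠ B → P ≠ C → eval P f = 0) :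
    ∃ e f', IsTripletFactor n X B A C e f' := by
  have key : ∀ P Q R : Pt, P ≠ Q → R ∈ X →
      (∀ S ∈ X, S ≠ P → S ≠ Q → S ≠ R → eval S f = 0) →
      eval R f ≠ 0 ∧ eval R (lineThrough P Q) ≠ 0 := by
    intro P Q R hPQ hR h
    have hne : f * lineThrough P Q ≠ 0 := mul_ne_zero hf0 (isLine_lineThrough hPQ).ne_zero
    by_contra hcon
    refine hne (hX.2 _ ((totalDegree_mul_le hf (isLine_lineThrough hPQ).le).trans (by omega))
      fun S hS => ?_)
    rw [eval_mul]
    by_cases h1 : S = P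
    · simp [h1, eval_lineThrough_left]
    by_cases h2 : S = Q
    · simp [h2, eval_lineThrough_right]
    by_cases h3 : S = R
    · subst h3
      by_contra h0
      exact hcon ⟨left_ne_zero_of_mul h0, right_ne_zero_of_mul h0⟩
    · rw [h S hS h1 h2 h3, zero_mul]
  have hfA := (key B C A hCB.symm hA fun S hS h1 h2 h3 => hfX S hS h3 h1 h2).1
  obtain ⟨hfB, heB⟩ := key A C B hAC hB fun S hS h1 h2 h3 => hfX S hS h1 h3 h2
  have hfC := (key A B C hAB hC fun S hS h1 h2 h3 => hfX S hS h1 h2 h3).1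
  set e := lineThrough A C with he
  have hc : (eval B f * eval B e)⁻¹ ≠ 0 := inv_ne_zero (mul_ne_zero hfB heB)
  have hdeg : (MvPolynomial.C (eval B f * eval B e)⁻¹ * f).totalDegree ≤ n - 1 :=
    (totalDegree_mul_le (totalDegree_C _).le hf).trans (by omega)
  refine ⟨e, MvPolynomial.C (eval B f * eval B e)⁻¹ * f, hA, hC, hAB, hCB, hAC,
    isLine_lineThrough hAC, eval_lineThrough_left A C, eval_lineThrough_right A C,
    ⟨(totalDegree_mul_le hdeg (isLine_lineThrough hAC).le).trans (by omega), ?_, ?_⟩, ?_⟩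
  · rw [eval_mul, eval_mul, eval_C, mul_assoc]
    exact inv_mul_cancel₀ (mul_ne_zero hfB heB)
  · intro P hP hPB
    by_cases h1 : P = A
    · simp [h1, he, eval_lineThrough_left]
    by_cases h2 : P = C
    · simp [h2, he, eval_lineThrough_right]
    · simp [hfX P hP h1 hPB h2]
  · intro P hP
    rw [eval_mul, eval_C, mul_ne_zero_iff_left hc]
    constructor
    · intro h
      by_contra hcon
      push Not at hcon
      exact h (hfX P hP hcon.1 hcon.2.1 hcon.2.2)
    · rintro (rfl | rfl | rfl) <;> assumption

namespace IsTripletFactor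

variable {n : ℕ} {X : Finset Pt} {B A C A' C' : Pt} {e f e' f' : Poly2}

lemma symm (h : IsTripletFactor n X B A C e f) : IsTripletFactor n X B C A e f where
  memA := h.memC
  memC := h.memA
  A_ne_B := h.C_ne_B
  C_ne_B := h.A_ne_B
  A_ne_C := h.A_ne_C.symm
  line := h.line
  evalA := h.evalC
  evalC := h.evalA
  fund := h.fund
  eval_ne P hP := (h.eval_ne P hP).trans (by tauto)

lemma mul_eq (hX : IsNCorrect n X) (h : IsTripletFactor n X B A C e f)
    (h' : IsTripletFactor n X B A' C' e' f') : f * e = f' * e' :=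
  h.fund.unique hX h'.fund

lemma evalB_f (h : IsTripletFactor n X B A C e f) : eval B f ≠ 0 := by
  have := h.fund.2.1
  intro h0
  simp [h0] at this

lemma evalB_e (h : IsTripletFactor n X B A C e f) : eval B e ≠ 0 := by
  have := h.fund.2.1
  intro h0
  simp [h0] at this

lemma evalA_f (h : IsTripletFactor n X B A C e f) : eval A f ≠ 0 :=
  (h.eval_ne A h.memA).2 (.inl rfl)

lemma evalC_f (h : IsTripletFactor n X B A C e f) : eval C f ≠ 0 :=
  (h.eval_ne C h.memC).2 (.inr (.inr rfl))

/-- Different triplets give different lines. -/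
lemma not_dvd (hX : IsNCorrect n X) (hB : B ∈ X) (h : IsTripletFactor n X B A C e f)
    (h' : IsTripletFactor n X B A' C' e' f') (hne : ({A, B, C} : Finset Pt) ≠ {A', B, C'}) :
    ¬ e' ∣ e := by
  intro hdvd
  have hff : ∀ P, eval P f' = 0 ↔ eval P f = 0 := by
    obtain ⟨u, hu⟩ := hdvd
    obtain ⟨v, hv⟩ := h'.line.dvd_symm h.line ⟨u, hu⟩
    have h1 : f' = f * u := by
      refine mul_right_cancel₀ h'.line.ne_zero ?_
      rw [← h.mul_eq hX h', hu]; ring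
    have h2 : f = f' * v := by
      refine mul_right_cancel₀ h.line.ne_zero ?_
      rw [h.mul_eq hX h', hv]; ring
    intro P
    constructor
    · intro h0; rw [h2, eval_mul, h0, zero_mul]
    · intro h0; rw [h1, eval_mul, h0, zero_mul]
  apply hne
  have hmem : ∀ P ∈ X, (P = A ∨ P = B ∨ P = C) ↔ (P = A' ∨ P = B ∨ P = C') := fun P hP => by
    rw [← h.eval_ne P hP, ← h'.eval_ne P hP, ne_eq, ne_eq, hff]
  ext P
  simp only [mem_insert, mem_singleton]
  by_cases hP : P ∈ X
  · exact hmem P hP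
  · refine iff_of_false ?_ ?_
    · rintro (rfl | rfl | rfl)
      exacts [hP h.memA, hP hB, hP h.memC]
    · rintro (rfl | rfl | rfl)
      exacts [hP h'.memA, hP hB, hP h'.memC]

lemma dvd_f (hX : IsNCorrect n X) (h : IsTripletFactor n X B A C e f)
    (h' : IsTripletFactor n X B A' C' e' f') (hd : ¬ e' ∣ e) : e' ∣ f :=
  (h'.line.prime.dvd_or_dvd ⟨f', by rw [h.mul_eq hX h', mul_comm]⟩).resolve_right hd

lemma eval_other (hX : IsNCorrect n X) (h : IsTripletFactor n X B A C e f)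
    (h' : IsTripletFactor n X B A' C' e' f') (hd : ¬ e' ∣ e) :
    eval A e' ≠ 0 ∧ eval C e' ≠ 0 :=
  ⟨fun h0 => h.evalA_f (eval_eq_zero_of_dvd (h.dvd_f hX h' hd) h0),
    fun h0 => h.evalC_f (eval_eq_zero_of_dvd (h.dvd_f hX h' hd) h0)⟩

lemma inter_unique (h : IsTripletFactor n X B A C e f)
    (h' : IsTripletFactor n X B A' C' e' f') (hd : ¬ e' ∣ e) {P Q : Pt}
    (hP : eval P e = 0) (hP' : eval P e' = 0) (hQ : eval Q e = 0) (hQ' : eval Q e' = 0) :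
    P = Q := by
  by_contra hPQ
  exact hd (h'.line.dvd_of_two h.line.le hPQ hP' hQ' hP hQ)

/-- The common cofactor of two different triplets. -/
lemma exists_cofactor (hX : IsNCorrect n X) (h : IsTripletFactor n X B A C e f)
    (h' : IsTripletFactor n X B A' C' e' f') (hd : ¬ e' ∣ e) :
    ∃ r : Poly2, f = e' * r ∧ f' = e * r ∧ r ≠ 0 ∧ r.totalDegree + 2 ≤ n ∧
      ∀ P ∈ X, eval P r ≠ 0 → P = A ∨ P = C ∨ P = A' ∨ P = C' ∨ P = B ∨
        (eval P e = 0 ∧ eval P e' = 0) := by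
  obtain ⟨r, hr⟩ := h.dvd_f hX h' hd
  have hr' : f' = e * r := by
    refine mul_right_cancel₀ h'.line.ne_zero ?_
    rw [← h.mul_eq hX h', hr]; ring
  have hr0 : r ≠ 0 := by
    rintro rfl
    apply h.evalB_f
    simp [hr]
  refine ⟨r, hr, hr', hr0, ?_, fun P hP hrP => ?_⟩
  · have := h.fund.1
    rw [hr, totalDegree_mul_of_isDomain (mul_ne_zero h'.line.ne_zero hr0) h.line.ne_zero,
      totalDegree_mul_of_isDomain h'.line.ne_zero hr0, h.line, h'.line] at this
    omega
  · by_cases h1 : eval P e' = 0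
    · by_cases h2 : eval P e = 0
      · simp [h1, h2]
      · have := (h'.eval_ne P hP).1 (by rw [hr', eval_mul]; exact mul_ne_zero h2 hrP)
        tauto
    · have := (h.eval_ne P hP).1 (by rw [hr, eval_mul]; exact mul_ne_zero h1 hrP)
      tauto

/-- A conic through the five nodes of two different triplets. -/
lemma exists_conic (hX : IsNCorrect n X) (h : IsTripletFactor n X B A C e f)
    (h' : IsTripletFactor n X B A' C' e' f') (hd : ¬ e' ∣ e) :
    ∃ q : Poly2, q ≠ 0 ∧ q.totalDegree ≤ 2 ∧ eval A q = 0 ∧ eval C q = 0 ∧ eval A' q = 0 ∧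
      eval C' q = 0 ∧ eval B q = 0 := by
  have hd' : ¬ e ∣ e' := fun hc => hd (h.line.dvd_symm h'.line hc)
  obtain ⟨hA', hC'⟩ := h'.eval_other hX h hd'
  have hAA : A ≠ A' := by rintro rfl; exact hA' h.evalA
  have hCC : C ≠ C' := by rintro rfl; exact hC' h.evalC
  set s := lineThrough A A' * lineThrough C C' with hs
  have hprod : eval B (e * e') ≠ 0 := by
    rw [eval_mul]; exact mul_ne_zero h.evalB_e h'.evalB_e
  refine ⟨MvPolynomial.C (eval B s) * (e * e') - MvPolynomial.C (eval B (e * e')) * s,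
    ?_, ?_, ?_, ?_, ?_, ?_, ?_⟩
  · intro h0
    have hes : e ∣ s := by
      refine ⟨MvPolynomial.C (eval B (e * e'))⁻¹ * MvPolynomial.C (eval B s) * e', ?_⟩
      have hC1 : (MvPolynomial.C (eval B (e * e'))⁻¹ * MvPolynomial.C (eval B (e * e')) : Poly2)
          = 1 := by rw [← C_mul, inv_mul_cancel₀ hprod, C_1]
      linear_combination (-MvPolynomial.C (eval B (e * e'))⁻¹) * h0 - s * hC1
    rcases h.line.prime.dvd_or_dvd hes with hc | hc
    · have := h.line.dvd_symm (isLine_lineThrough hAA) hc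
      exact hA' (eval_eq_zero_of_dvd this (eval_lineThrough_right A A'))
    · have := h.line.dvd_symm (isLine_lineThrough hCC) hc
      exact hC' (eval_eq_zero_of_dvd this (eval_lineThrough_right C C'))
  · refine (totalDegree_sub _ _).trans (max_le ?_ ?_)
    · simpa using totalDegree_mul_le (totalDegree_C (eval B s)).le
        (totalDegree_mul_le h.line.le h'.line.le)
    · simpa using totalDegree_mul_le (totalDegree_C (eval B (e * e'))).le
        (totalDegree_mul_le (isLine_lineThrough hAA).le (isLine_lineThrough hCC).le)
  · simp [hs, h.evalA, eval_lineThrough_left]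
  · simp [hs, h.evalC, eval_lineThrough_left]
  · simp [hs, h'.evalA, eval_lineThrough_right]
  · simp [hs, h'.evalC, eval_lineThrough_right]
  · simp [hs]; ring

/-- The lines of two different triplets meet at a node lying on no further factor. -/
lemma exists_inter (hX : IsNCorrect n X) (h : IsTripletFactor n X B A C e f)
    (h' : IsTripletFactor n X B A' C' e' f') (hd : ¬ e' ∣ e) :
    ∃ D ∈ X, eval D e = 0 ∧ eval D e' = 0 ∧ ∃ r, f = e' * r ∧ eval D r ≠ 0 := by
  obtain ⟨r, hr, -, hr0, hrdeg, hrX⟩ := h.exists_cofactor hX h' hd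
  obtain ⟨q, hq0, hqdeg, hqA, hqC, hqA', hqC', hqB⟩ := h.exists_conic hX h' hd
  by_contra hcon
  push Not at hcon
  refine mul_ne_zero hr0 hq0 (hX.2 _ ((totalDegree_mul_le le_rfl hqdeg).trans hrdeg)
    fun P hP => ?_)
  rw [eval_mul]
  by_cases hrP : eval P r = 0
  · rw [hrP, zero_mul]
  · rcases hrX P hP hrP with rfl | rfl | rfl | rfl | rfl | ⟨h1, h2⟩
    · rw [hqA, mul_zero]
    · rw [hqC, mul_zero]
    · rw [hqA', mul_zero]
    · rw [hqC', mul_zero]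
    · rw [hqB, mul_zero]
    · exact absurd (hcon P hP h1 h2 r hr) hrP

/-- The lines of three different triplets are not concurrent. -/
lemma eval_ne_zero_of_inter {A'' C'' : Pt} {e'' f'' : Poly2} (hX : IsNCorrect n X)
    (h : IsTripletFactor n X B A C e f) (h' : IsTripletFactor n X B A' C' e' f')
    (h'' : IsTripletFactor n X B A'' C'' e'' f'') (hd : ¬ e' ∣ e) (hd' : ¬ e'' ∣ e)
    (hd'' : ¬ e'' ∣ e') {P : Pt} (hP : eval P e = 0) (hP' : eval P e' = 0) :
    eval P e'' ≠ 0 := by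
  obtain ⟨D, -, hDe, hDe', r, hr, hDr⟩ := h.exists_inter hX h' hd
  obtain rfl := h.inter_unique h' hd hP hP' hDe hDe'
  have hk : e'' ∣ e' * r := hr ▸ h.dvd_f hX h'' hd'
  exact fun h0 => hDr (eval_eq_zero_of_dvd ((h''.line.prime.dvd_or_dvd hk).resolve_left hd'') h0)

/-- In a `GC_n` set, two different triplets with the common node `B` have nodes collinear
with `B`. -/
lemma exists_line (hX : IsGC n X) (hB : B ∈ X) (h : IsTripletFactor n X B A C e f)
    (h' : IsTripletFactor n X B A' C' e' f') (hd : ¬ e' ∣ e) :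
    ∃ g : Poly2, IsLine g ∧ eval B g = 0 ∧ (eval A g = 0 ∨ eval C g = 0) ∧
      (eval A' g = 0 ∨ eval C' g = 0) := by
  obtain ⟨r, hr, -, hr0, hrdeg, hrX⟩ := h.exists_cofactor hX.1 h' hd
  obtain ⟨q, hq0, hqdeg, hqA, hqC, hqA', hqC', hqB⟩ := h.exists_conic hX.1 h' hd
  obtain ⟨D, hDX, hDe, hDe', r', hr', hDr⟩ := h.exists_inter hX.1 h' hd
  obtain rfl : r = r' := mul_left_cancel₀ h'.line.ne_zero (hr.symm.trans hr')
  have hrq : ∀ P ∈ X, P ≠ D → eval P (r * q) = 0 := by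
    intro P hP hPD
    rw [eval_mul]
    by_cases hrP : eval P r = 0
    · rw [hrP, zero_mul]
    · rcases hrX P hP hrP with rfl | rfl | rfl | rfl | rfl | ⟨h1, h2⟩
      · rw [hqA, mul_zero]
      · rw [hqC, mul_zero]
      · rw [hqA', mul_zero]
      · rw [hqC', mul_zero]
      · rw [hqB, mul_zero]
      · exact absurd (h.inter_unique h' hd h1 h2 hDe hDe') hPD
  have hrqdeg : (r * q).totalDegree ≤ n := (totalDegree_mul_le le_rfl hqdeg).trans hrdeg
  have hrqD : eval D (r * q) ≠ 0 := by
    intro h0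
    refine mul_ne_zero hr0 hq0 (hX.1.2 _ hrqdeg fun P hP => ?_)
    by_cases hPD : P = D
    · rw [hPD, h0]
    · exact hrq P hP hPD
  have hqD : eval D q ≠ 0 := by
    rw [eval_mul] at hrqD; exact right_ne_zero_of_mul hrqD
  obtain ⟨p, hp, g, hg, hpg⟩ := hX.2 D hDX
  have hpeq : MvPolynomial.C (eval D (r * q)) * p = r * q := by
    rw [← sub_eq_zero]
    refine hX.1.2 _ ((totalDegree_sub _ _).trans (max_le ?_ hrqdeg)) fun P hP => ?_
    · simpa using totalDegree_mul_le (totalDegree_C (eval D (r * q))).le hp.1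
    · by_cases hPD : P = D
      · subst hPD
        rw [eval_sub, eval_mul, eval_C, hp.2.1]; ring
      · rw [eval_sub, eval_mul, hp.2.2 P hP hPD, hrq P hP hPD]; ring
  have hBD : B ≠ D := by rintro rfl; exact h.evalB_e hDe
  have hpB := hp.2.2 B hB hBD
  rw [hpg, map_prod, Finset.prod_eq_zero_iff] at hpB
  obtain ⟨i, -, hi⟩ := hpB
  have hgi : IsLine (g i) := hg i
  have hgr : ¬ g i ∣ r := fun hc => h.evalB_f (by
    rw [hr, eval_mul, eval_eq_zero_of_dvd hc hi, mul_zero])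
  have hgq : g i ∣ q := by
    refine (hgi.prime.dvd_or_dvd (?_ : g i ∣ r * q)).resolve_left hgr
    rw [← hpeq, hpg]
    exact (Finset.dvd_prod_of_mem g (mem_univ i)).mul_left _
  obtain ⟨k, hk⟩ := hgq
  have hk0 : k ≠ 0 := by rintro rfl; simp [hk] at hq0
  have hkdeg : k.totalDegree ≤ 1 := by
    rw [hk, totalDegree_mul_of_isDomain hgi.ne_zero hk0, hgi] at hqdeg
    omega
  have pair : ∀ (P Q : Pt) (ℓ : Poly2), P ≠ Q → IsLine ℓ → eval P ℓ = 0 → eval Q ℓ = 0 →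
      eval D ℓ = 0 → eval P q = 0 → eval Q q = 0 → eval P (g i) = 0 ∨ eval Q (g i) = 0 := by
    intro P Q ℓ hPQ hℓ hP hQ hD hPq hQq
    by_contra hcon
    push Not at hcon
    rw [hk, eval_mul] at hPq hQq
    have hℓk := hℓ.dvd_of_two hkdeg hPQ hP hQ ((mul_eq_zero.1 hPq).resolve_left hcon.1)
      ((mul_eq_zero.1 hQq).resolve_left hcon.2)
    exact hqD (by rw [hk, eval_mul, eval_eq_zero_of_dvd hℓk hD, mul_zero])
  exact ⟨g i, hgi, hi, pair A C e h.A_ne_C h.line h.evalA h.evalC hDe hqA hqC,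
    pair A' C' e' h'.A_ne_C h'.line h'.evalA h'.evalC hDe' hqA' hqC'⟩

end IsTripletFactor

lemma zeroSet_eq_of_dvd {ℓ m : Poly2} (hℓ : IsLine ℓ) (hm : IsLine m) (h : ℓ ∣ m) :
    zeroSet ℓ = zeroSet m :=
  Set.ext fun _ => ⟨eval_eq_zero_of_dvd h, eval_eq_zero_of_dvd (hℓ.dvd_symm hm h)⟩

/-! ### Families of triplets with a common node -/

section Family

variable {n : ℕ} {X : Finset Pt} {B : Pt} {ι : Type*} [Fintype ι] {A C : ι → Pt}
  {e f : ι → Poly2}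

lemma prod_lines_dvd (hX : IsNCorrect n X)
    (h : ∀ i, IsTripletFactor n X B (A i) (C i) (e i) (f i))
    (hd : ∀ i j, i ≠ j → ¬ e j ∣ e i) (i : ι) : ∏ k, e k ∣ f i * e i := by
  refine Fintype.prod_dvd_of_isRelPrime (fun j k hjk => ?_) fun k => ?_
  · exact (h j).line.prime.irreducible.isRelPrime_iff_not_dvd.2 (hd k j hjk.symm)
  · rw [(h i).mul_eq hX (h k)]
    exact dvd_mul_left _ _

lemma card_triplets_le (hX : IsNCorrect n X)
    (h : ∀ i, IsTripletFactor n X B (A i) (C i) (e i) (f i))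
    (hd : ∀ i j, i ≠ j → ¬ e j ∣ e i) : Fintype.card ι ≤ n := by
  rcases isEmpty_or_nonempty ι with hι | ⟨⟨i⟩⟩
  · simp
  · obtain ⟨u, hu⟩ := prod_lines_dvd hX h hd i
    have h0 : f i * e i ≠ 0 := fun h0 => by simpa [h0] using (h i).fund.2.1
    have hdeg := (h i).fund.1
    rw [hu] at h0 hdeg
    rw [totalDegree_mul_of_isDomain (left_ne_zero_of_mul h0) (right_ne_zero_of_mul h0),
      totalDegree_finset_prod_lines _ _ fun k _ => (h k).line, Finset.card_univ] at hdeg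
    omega

lemma fund_eq_const_mul_prod (hX : IsNCorrect n X)
    (h : ∀ i, IsTripletFactor n X B (A i) (C i) (e i) (f i))
    (hd : ∀ i j, i ≠ j → ¬ e j ∣ e i) (hcard : Fintype.card ι = n) (i : ι) :
    ∃ c : ℝ, c ≠ 0 ∧ f i * e i = MvPolynomial.C c * ∏ k, e k := by
  obtain ⟨u, hu⟩ := prod_lines_dvd hX h hd i
  have h0 : f i * e i ≠ 0 := fun h0 => by simpa [h0] using (h i).fund.2.1
  have hdeg := (h i).fund.1
  rw [hu] at h0 hdeg
  rw [totalDegree_mul_of_isDomain (left_ne_zero_of_mul h0) (right_ne_zero_of_mul h0),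
    totalDegree_finset_prod_lines _ _ fun k _ => (h k).line, Finset.card_univ, hcard] at hdeg
  have hu0 := right_ne_zero_of_mul h0
  have huC := totalDegree_eq_zero_iff_eq_C.1 (by omega : u.totalDegree = 0)
  refine ⟨coeff 0 u, fun hc => hu0 (by rw [huC, hc, C_0]), ?_⟩
  rw [← huC, hu, mul_comm]

lemma exists_dvd_line (hX : IsNCorrect n X)
    (h : ∀ i, IsTripletFactor n X B (A i) (C i) (e i) (f i))
    (hd : ∀ i j, i ≠ j → ¬ e j ∣ e i) (hcard : Fintype.card ι = n) (i : ι) {M : Poly2}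
    (hM : IsLine M) (hdvd : M ∣ f i) : ∃ k, k ≠ i ∧ M ∣ e k := by
  obtain ⟨c, hc, hprod⟩ := fund_eq_const_mul_prod hX h hd hcard i
  rw [← Finset.mul_prod_erase univ e (mem_univ i), mul_left_comm, mul_comm] at hprod
  rw [mul_left_cancel₀ (h i).line.ne_zero hprod] at hdvd
  have hMc : ¬ M ∣ MvPolynomial.C c := fun hMc =>
    hM.prime.not_isUnit (isUnit_of_dvd_unit hMc ((isUnit_iff_ne_zero.2 hc).map MvPolynomial.C))
  obtain ⟨k, hk, hk'⟩ :=
    hM.prime.exists_mem_finset_dvd ((hM.prime.dvd_or_dvd hdvd).resolve_left hMc)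
  exact ⟨k, (Finset.mem_erase.1 hk).1, hk'⟩

lemma exists_other_line (hX : IsNCorrect n X)
    (h : ∀ i, IsTripletFactor n X B (A i) (C i) (e i) (f i))
    (hd : ∀ i j, i ≠ j → ¬ e j ∣ e i) (hcard : Fintype.card ι = n) (i : ι) {P : Pt}
    (hP : eval P (f i) = 0) : ∃ k, k ≠ i ∧ eval P (e k) = 0 := by
  obtain ⟨c, hc, hprod⟩ := fund_eq_const_mul_prod hX h hd hcard i
  rw [← Finset.mul_prod_erase univ e (mem_univ i), mul_left_comm, mul_comm] at hprod
  rw [mul_left_cancel₀ (h i).line.ne_zero hprod, eval_mul, eval_C, map_prod] at hP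
  obtain ⟨k, hk, hk'⟩ := Finset.prod_eq_zero_iff.1 ((mul_eq_zero.1 hP).resolve_left hc)
  exact ⟨k, (Finset.mem_erase.1 hk).1, hk'⟩

lemma isMaximalLine_of_card_eq (hX : IsNCorrect n X)
    (h : ∀ i, IsTripletFactor n X B (A i) (C i) (e i) (f i))
    (hd : ∀ i j, i ≠ j → ¬ e j ∣ e i) (hcard : Fintype.card ι = n) (i : ι) :
    IsMaximalLine n X (e i) := by
  refine ⟨(h i).line, ?_⟩
  have hD : ∀ k, ∃ D, k ≠ i → D ∈ X ∧ eval D (e i) = 0 ∧ eval D (e k) = 0 := by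
    intro k
    by_cases hk : k = i
    · exact ⟨0, fun h0 => absurd hk h0⟩
    · obtain ⟨D, hDX, hDi, hDk, -⟩ := (h i).exists_inter hX (h k) (hd i k (Ne.symm hk))
      exact ⟨D, fun _ => ⟨hDX, hDi, hDk⟩⟩
  choose D hD using hD
  have heq : zerosIn X (e i) = insert (A i) (insert (C i) ((univ.erase i).image D)) := by
    ext P
    simp only [zerosIn, mem_filter, mem_insert, mem_image, mem_erase, mem_univ, and_true]
    constructor
    · rintro ⟨hPX, hP⟩
      by_cases hf : eval P (f i) = 0
      · obtain ⟨k, hk, hPk⟩ := exists_other_line hX h hd hcard i hf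
        exact .inr (.inr ⟨k, hk, ((h i).inter_unique (h k) (hd i k hk.symm) (hD k hk).2.1
          (hD k hk).2.2 hP hPk)⟩)
      · rcases ((h i).eval_ne P hPX).1 hf with h1 | rfl | h1
        · exact .inl h1
        · exact absurd hP (h i).evalB_e
        · exact .inr (.inl h1)
    · rintro (rfl | rfl | ⟨k, hk, rfl⟩)
      · exact ⟨(h i).memA, (h i).evalA⟩
      · exact ⟨(h i).memC, (h i).evalC⟩
      · exact ⟨(hD k hk).1, (hD k hk).2.1⟩
  have hinj : Set.InjOn D ↑(univ.erase i) := by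
    intro j hj k hk hjk
    simp only [coe_erase, coe_univ, Set.mem_sdiff, Set.mem_univ, Set.mem_singleton_iff,
      true_and] at hj hk
    by_contra hne
    refine (h i).eval_ne_zero_of_inter hX (h j) (h k) (hd i j (Ne.symm hj)) (hd i k (Ne.symm hk))
      (hd j k hne) (hD j hj).2.1 (hD j hj).2.2 ?_
    rw [hjk]; exact (hD k hk).2.2
  have hother : ∀ k, k ≠ i → D k ≠ A i ∧ D k ≠ C i := fun k hk =>
    ⟨fun h0 => ((h i).eval_other hX (h k) (hd i k hk.symm)).1 (h0 ▸ (hD k hk).2.2),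
      fun h0 => ((h i).eval_other hX (h k) (hd i k hk.symm)).2 (h0 ▸ (hD k hk).2.2)⟩
  rw [heq, Finset.card_insert_of_notMem, Finset.card_insert_of_notMem,
    Finset.card_image_of_injOn hinj, Finset.card_erase_of_mem (mem_univ i), Finset.card_univ,
    hcard]
  · have : 0 < n := hcard ▸ Fintype.card_pos_iff.2 ⟨i⟩
    omega
  · simp only [mem_image, mem_erase, mem_univ, and_true, not_exists, not_and]
    exact fun k hk => (hother k hk).2
  · simp only [mem_insert, mem_image, mem_erase, mem_univ, and_true, not_or, not_exists, not_and]
    exact ⟨(h i).A_ne_C, fun k hk => (hother k hk).1⟩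

/-- A maximal line divides the fundamental polynomial of each node off it. -/
lemma IsMaximalLine.dvd_fund {M : Poly2} (hM : IsMaximalLine n X M) {D : Pt} {p : Poly2}
    (hp : IsFund n X D p) (hD : eval D M ≠ 0) : M ∣ p := by
  refine hM.1.dvd_of_card hp.1 (zerosIn X M) (by rw [hM.2]; omega) ?_ ?_
  · exact fun P hP => (mem_filter.1 hP).2
  · rintro P hP
    refine hp.2.2 P (mem_filter.1 hP).1 ?_
    rintro rfl
    exact hD (mem_filter.1 hP).2

lemma maximalLines_avoiding_eq_range (hX : IsNCorrect n X)
    (h : ∀ i, IsTripletFactor n X B (A i) (C i) (e i) (f i))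
    (hd : ∀ i j, i ≠ j → ¬ e j ∣ e i) (hcard : Fintype.card ι = n) [Nonempty ι] :
    {Z ∈ maximalLines n X | B ∉ Z} = Set.range fun i => zeroSet (e i) := by
  ext Z
  constructor
  · rintro ⟨⟨M, hM, rfl⟩, hBM⟩
    obtain ⟨i⟩ := ‹Nonempty ι›
    have hdvd := hM.dvd_fund (h i).fund hBM
    obtain ⟨k, hk⟩ : ∃ k, M ∣ e k := by
      rcases hM.1.prime.dvd_or_dvd hdvd with hc | hc
      · obtain ⟨k, -, hk⟩ := exists_dvd_line hX h hd hcard i hM.1 hc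
        exact ⟨k, hk⟩
      · exact ⟨i, hc⟩
    exact ⟨k, (zeroSet_eq_of_dvd hM.1 (h k).line hk).symm⟩
  · rintro ⟨i, rfl⟩
    exact ⟨⟨e i, isMaximalLine_of_card_eq hX h hd hcard i, rfl⟩, (h i).evalB_e⟩

lemma ncard_maximalLines_avoiding (hX : IsNCorrect n X)
    (h : ∀ i, IsTripletFactor n X B (A i) (C i) (e i) (f i))
    (hd : ∀ i j, i ≠ j → ¬ e j ∣ e i) (hcard : Fintype.card ι = n) [Nonempty ι] :
    {Z ∈ maximalLines n X | B ∉ Z}.ncard = n := by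
  rw [maximalLines_avoiding_eq_range hX h hd hcard, ← Set.image_univ,
    Set.ncard_image_of_injective, Set.ncard_univ, Nat.card_eq_fintype_card, hcard]
  intro i j hij
  by_contra hne
  have : A i ∈ zeroSet (e j) := by
    rw [← show zeroSet (e i) = zeroSet (e j) from hij]; exact (h i).evalA
  exact ((h i).eval_other hX (h j) (hd i j hne)).1 this

end Family

/-! ### Used two-node lines -/

/-- The triplet arising from a `2`-node line used by a node. -/
lemma IsTwoNodeLineOf.exists_isTripletFactor {n : ℕ} (hn : 2 ≤ n) {X : Finset Pt}
    (hX : IsNCorrect n X) {A B C : Pt} (hB : B ∈ X) (hC : C ∈ X) {ℓ : Poly2}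
    (hℓ : IsTwoNodeLineOf X ℓ A B) (hu : Uses n X C ℓ) :
    ∃ e f, IsTripletFactor n X B A C e f := by
  obtain ⟨hline, hAB, hz⟩ := hℓ
  obtain ⟨p, hp, f, rfl⟩ := hu
  have hA : A ∈ zerosIn X ℓ := by rw [hz]; simp
  have hBz : B ∈ zerosIn X ℓ := by rw [hz]; simp
  simp only [zerosIn, mem_filter] at hA hBz
  have hCℓ : eval C ℓ ≠ 0 := fun h0 => by simpa [h0] using hp.2.1
  have hf0 : f ≠ 0 := by rintro rfl; simpa using hp.2.1
  have hdeg := hp.1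
  rw [totalDegree_mul_of_isDomain hline.ne_zero hf0, hline] at hdeg
  refine _root_.exists_isTripletFactor hn hX hA.1 hB hC hAB (fun h0 => hCℓ (h0 ▸ hBz.2))
    (fun h0 => hCℓ (h0 ▸ hA.2)) hf0 (by omega) fun P hP hPA hPB hPC => ?_
  have h0 := hp.2.2 P hP hPC
  rw [eval_mul] at h0
  refine (mul_eq_zero.1 h0).resolve_left fun hPℓ => ?_
  have : P ∈ zerosIn X ℓ := mem_filter.2 ⟨hP, hPℓ⟩
  rw [hz] at this
  simp [hPA, hPB] at this

lemma IsTwoNodeLineOf.eq_or_eq {X : Finset Pt} {A B P : Pt} {ℓ : Poly2}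
    (hℓ : IsTwoNodeLineOf X ℓ A B) (hP : P ∈ X) (h : eval P ℓ = 0) : P = A ∨ P = B := by
  have : P ∈ zerosIn X ℓ := mem_filter.2 ⟨hP, h⟩
  rw [hℓ.2.2] at this
  simpa using this

lemma IsTwoNodeLineOf.eval_left {X : Finset Pt} {A B : Pt} {ℓ : Poly2}
    (hℓ : IsTwoNodeLineOf X ℓ A B) : eval A ℓ = 0 := by
  have : A ∈ zerosIn X ℓ := by rw [hℓ.2.2]; simp
  exact (mem_filter.1 this).2

lemma IsTwoNodeLineOf.eval_right {X : Finset Pt} {A B : Pt} {ℓ : Poly2}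
    (hℓ : IsTwoNodeLineOf X ℓ A B) : eval B ℓ = 0 := by
  have : B ∈ zerosIn X ℓ := by rw [hℓ.2.2]; simp
  exact (mem_filter.1 this).2

namespace IsTripletFactor

variable {n : ℕ} {X : Finset Pt} {B A C A' C' : Pt} {e f e' f' ℓ ℓ' : Poly2}

lemma eval_ne_zero_of_twoNode (hX : IsNCorrect n X) (h : IsTripletFactor n X B A C e f)
    (h' : IsTripletFactor n X B A' C' e' f') (hd : ¬ e' ∣ e) (hℓ : IsTwoNodeLineOf X ℓ A B)
    {g : Poly2} (hg : IsLine g) (hgB : eval B g = 0) (hgA : eval A g = 0) :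
    eval A' g ≠ 0 ∧ eval C' g ≠ 0 := by
  have hgℓ : g ∣ ℓ := hg.dvd_of_two hℓ.1.le h.A_ne_B hgA hgB hℓ.eval_left hℓ.eval_right
  have key : ∀ U ∈ X, eval U e' = 0 → eval U g ≠ 0 := by
    intro U hU hUe hUg
    rcases hℓ.eq_or_eq hU (eval_eq_zero_of_dvd hgℓ hUg) with rfl | rfl
    · exact (h.eval_other hX h' hd).1 hUe
    · exact h'.evalB_e hUe
  exact ⟨key A' h'.memA h'.evalA, key C' h'.memC h'.evalC⟩

/-- If two `2`-node lines through `B` arise from different triplets, then the third nodes of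
the triplets are collinear with `B`. -/
lemma exists_line_of_twoNode (hX : IsGC n X) (hB : B ∈ X) (h : IsTripletFactor n X B A C e f)
    (h' : IsTripletFactor n X B A' C' e' f') (hd : ¬ e' ∣ e) (hℓ : IsTwoNodeLineOf X ℓ A B)
    (hℓ' : IsTwoNodeLineOf X ℓ' A' B) :
    ∃ g, IsLine g ∧ eval B g = 0 ∧ eval C g = 0 ∧ eval C' g = 0 := by
  obtain ⟨g, hg, hgB, h1, h2⟩ := h.exists_line hX hB h' hd
  have hd' : ¬ e ∣ e' := fun hc => hd (h.line.dvd_symm h'.line hc)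
  have hA : eval A g ≠ 0 := fun h0 => by
    have := h.eval_ne_zero_of_twoNode hX.1 h' hd hℓ hg hgB h0
    tauto
  have hA' : eval A' g ≠ 0 := fun h0 => by
    have := h'.eval_ne_zero_of_twoNode hX.1 h hd' hℓ' hg hgB h0
    tauto
  exact ⟨g, hg, hgB, h1.resolve_left hA, h2.resolve_left hA'⟩

/-- In the presence of a third used `2`-node line through `B`, two used `2`-node lines through
`B` arise from different triplets. -/
lemma triplet_ne {A'' C'' : Pt} {e'' f'' : Poly2} (hX : IsGC n X) (hB : B ∈ X)
    (h : IsTripletFactor n X B A C e f) (h' : IsTripletFactor n X B A' C' e' f')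
    (h'' : IsTripletFactor n X B A'' C'' e'' f'') (hℓ : IsTwoNodeLineOf X ℓ A B)
    (hℓ' : IsTwoNodeLineOf X ℓ' A' B) (h1 : A ≠ A') (h2 : A ≠ A'') (h3 : A' ≠ A'') :
    ({A, B, C} : Finset Pt) ≠ {A', B, C'} := by
  intro heq
  obtain rfl : A' = C := by
    have : A' ∈ ({A, B, C} : Finset Pt) := by rw [heq]; simp
    simpa [h1.symm, h'.A_ne_B] using this
  have hne : ({A, B, A'} : Finset Pt) ≠ {A'', B, C''} := by
    intro hc
    have : A'' ∈ ({A, B, A'} : Finset Pt) := by rw [hc]; simp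
    simp [h2.symm, h3.symm, h''.A_ne_B] at this
  have hd := h.not_dvd hX.1 hB h'' hne
  obtain ⟨g, hg, hgB, hgA | hgA, hg2⟩ := h.exists_line hX hB h'' hd
  · have := h.eval_ne_zero_of_twoNode hX.1 h'' hd hℓ hg hgB hgA
    tauto
  · have := h.symm.eval_ne_zero_of_twoNode hX.1 h'' hd hℓ' hg hgB hgA
    tauto

end IsTripletFactor

section Extremal

variable {n : ℕ} {X : Finset Pt} {B : Pt} {A C : Fin n → Pt} {e f ℓ : Fin n → Poly2}

/-- With `n` used `2`-node lines through `B`, the remaining nodes of the triplets and `B` lie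
on a line meeting the other `n` lines in these nodes. -/
lemma exists_line_through_common_node (hn : 2 ≤ n) (hX : IsGC n X) (hB : B ∈ X)
    (h : ∀ i, IsTripletFactor n X B (A i) (C i) (e i) (f i))
    (hd : ∀ i j, i ≠ j → ¬ e j ∣ e i) (hℓ : ∀ i, IsTwoNodeLineOf X (ℓ i) (A i) B) :
    ∃ e₀, IsLine e₀ ∧ eval B e₀ = 0 ∧ (∀ i, eval (C i) e₀ = 0) ∧ (∀ i, eval (A i) e₀ ≠ 0) ∧
      ∀ i P, eval P e₀ = 0 → eval P (e i) = 0 → P = C i := by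
  let i₀ : Fin n := ⟨0, by omega⟩
  have hline : IsLine (lineThrough B (C i₀)) := isLine_lineThrough (h i₀).C_ne_B.symm
  have hC : ∀ i, eval (C i) (lineThrough B (C i₀)) = 0 := by
    intro i
    by_cases hi : i₀ = i
    · rw [← hi]; exact eval_lineThrough_right _ _
    · obtain ⟨g, hg, hgB, hg1, hg2⟩ :=
        (h i₀).exists_line_of_twoNode hX hB (h i) (hd i₀ i hi) (hℓ i₀) (hℓ i)
      exact eval_eq_zero_of_dvd (hg.dvd_of_two hline.le (h i₀).C_ne_B hg1 hgB
        (eval_lineThrough_right _ _) (eval_lineThrough_left _ _)) hg2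
  refine ⟨_, hline, eval_lineThrough_left _ _, hC, fun i hA => ?_, fun i P hP hPi => ?_⟩
  · have hdvd := hline.dvd_of_two (hℓ i).1.le (h i).A_ne_B hA (eval_lineThrough_left _ _)
      (hℓ i).eval_left (hℓ i).eval_right
    rcases (hℓ i).eq_or_eq (h i).memC (eval_eq_zero_of_dvd hdvd (hC i)) with hc | hc
    · exact (h i).A_ne_C hc.symm
    · exact (h i).C_ne_B hc
  · by_contra hne
    exact (h i).evalB_e (eval_eq_zero_of_dvd (hline.dvd_of_two (h i).line.le hne hP (hC i) hPi
      (h i).evalC) (eval_lineThrough_left _ _))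

variable {e₀ : Poly2}

lemma exists_line_eval_eq_zero (hX : IsNCorrect n X)
    (h : ∀ i, IsTripletFactor n X B (A i) (C i) (e i) (f i))
    (hd : ∀ i j, i ≠ j → ¬ e j ∣ e i) (hn : 2 ≤ n) {P : Pt} (hP : P ∈ X) (hPB : P ≠ B) :
    ∃ i, eval P (e i) = 0 := by
  let i₀ : Fin n := ⟨0, by omega⟩
  have h0 := (h i₀).fund.2.2 P hP hPB
  rw [eval_mul] at h0
  rcases mul_eq_zero.1 h0 with h0 | h0
  · obtain ⟨k, -, hk⟩ := exists_other_line hX h hd (Fintype.card_fin n) i₀ h0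
    exact ⟨k, hk⟩
  · exact ⟨i₀, h0⟩

lemma maximalLines_through_eq_singleton (hn : 2 ≤ n) (hX : IsNCorrect n X) (hB : B ∈ X)
    (h : ∀ i, IsTripletFactor n X B (A i) (C i) (e i) (f i))
    (hd : ∀ i j, i ≠ j → ¬ e j ∣ e i) (hℓ : ∀ i, IsTwoNodeLineOf X (ℓ i) (A i) B)
    (h₀ : IsLine e₀) (h₀B : eval B e₀ = 0) (h₀C : ∀ i, eval (C i) e₀ = 0)
    (h₀inter : ∀ i P, eval P e₀ = 0 → eval P (e i) = 0 → P = C i) :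
    {Z ∈ maximalLines n X | B ∈ Z} = {zeroSet e₀} := by
  have hmax : IsMaximalLine n X e₀ := by
    refine ⟨h₀, ?_⟩
    have heq : zerosIn X e₀ = insert B (univ.image C) := by
      ext P
      simp only [zerosIn, mem_filter, mem_insert, mem_image, mem_univ, true_and]
      constructor
      · rintro ⟨hPX, hP⟩
        by_cases hPB : P = B
        · exact .inl hPB
        · obtain ⟨i, hi⟩ := exists_line_eval_eq_zero hX h hd hn hPX hPB
          exact .inr ⟨i, (h₀inter i P hP hi).symm⟩
      · rintro (rfl | ⟨i, rfl⟩)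
        · exact ⟨hB, h₀B⟩
        · exact ⟨(h i).memC, h₀C i⟩
    have hinj : Function.Injective C := by
      intro i j hij
      by_contra hne
      exact ((h i).eval_other hX (h j) (hd i j hne)).2 (hij ▸ (h j).evalC)
    rw [heq, Finset.card_insert_of_notMem, Finset.card_image_of_injective _ hinj, Finset.card_univ,
      Fintype.card_fin]
    simp only [mem_image, mem_univ, true_and, not_exists]
    exact fun i => (h i).C_ne_B
  ext Z
  simp only [Set.mem_sep_iff, Set.mem_singleton_iff]
  constructor
  · rintro ⟨⟨M, hM, rfl⟩, hBM⟩
    by_contra hne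
    let i₀ : Fin n := ⟨0, by omega⟩
    have hCM : eval (C i₀) M ≠ 0 := fun hCM => hne (zeroSet_eq_of_dvd hM.1 h₀
      (hM.1.dvd_of_two h₀.le (h i₀).C_ne_B hCM hBM (h₀C i₀) h₀B))
    have hfC := (h i₀).evalC_f
    have hℓC : eval (C i₀) (ℓ i₀) ≠ 0 := fun hc =>
      ((hℓ i₀).eq_or_eq (h i₀).memC hc).elim (h i₀).A_ne_C.symm (h i₀).C_ne_B
    have hfdeg : (f i₀).totalDegree + 1 ≤ n := by
      have hf0 : f i₀ ≠ 0 := fun h0 => hfC (by rw [h0, map_zero])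
      have := (h i₀).fund.1
      rwa [totalDegree_mul_of_isDomain hf0 (h i₀).line.ne_zero, (h i₀).line] at this
    have hdvd : M ∣ f i₀ * ℓ i₀ := by
      refine hM.1.dvd_of_card ((totalDegree_mul_le le_rfl (hℓ i₀).1.le).trans hfdeg) (zerosIn X M)
        (by rw [hM.2]; omega) (fun P hP => (mem_filter.1 hP).2) fun P hP => ?_
      obtain ⟨hPX, hP⟩ := mem_filter.1 hP
      rw [eval_mul]
      by_cases hfP : eval P (f i₀) = 0
      · rw [hfP, zero_mul]
      · rcases ((h i₀).eval_ne P hPX).1 hfP with rfl | rfl | rfl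
        · rw [(hℓ i₀).eval_left, mul_zero]
        · rw [(hℓ i₀).eval_right, mul_zero]
        · exact absurd hP hCM
    rcases hM.1.prime.dvd_or_dvd hdvd with hc | hc
    · exact (h i₀).evalB_f (eval_eq_zero_of_dvd hc hBM)
    · have hz : zerosIn X M = zerosIn X (ℓ i₀) := by
        have := zeroSet_eq_of_dvd hM.1 (hℓ i₀).1 hc
        ext P
        have hP : P ∈ zeroSet M ↔ P ∈ zeroSet (ℓ i₀) := by rw [this]
        simpa [zerosIn, zeroSet] using fun _ => hP
      have := hM.2
      rw [hz, (hℓ i₀).2.2, Finset.card_pair (h i₀).A_ne_B] at this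
      omega
  · rintro rfl
    exact ⟨⟨e₀, hmax, rfl⟩, h₀B⟩

lemma isCarnicerGasca_of_lines (hn : 2 ≤ n) (hX : IsNCorrect n X) (hB : B ∈ X)
    (h : ∀ i, IsTripletFactor n X B (A i) (C i) (e i) (f i))
    (hd : ∀ i j, i ≠ j → ¬ e j ∣ e i) (hℓ : ∀ i, IsTwoNodeLineOf X (ℓ i) (A i) B)
    (h₀ : IsLine e₀) (h₀B : eval B e₀ = 0) (h₀C : ∀ i, eval (C i) e₀ = 0)
    (h₀A : ∀ i, eval (A i) e₀ ≠ 0)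
    (h₀inter : ∀ i P, eval P e₀ = 0 → eval P (e i) = 0 → P = C i) :
    IsCarnicerGasca n X := by
  have hC_other : ∀ i j, i ≠ j → eval (C i) (e j) ≠ 0 := fun i j hij =>
    ((h i).eval_other hX (h j) (hd i j hij)).2
  refine ⟨Fin.cons e₀ e, Fin.cons B A, ⟨?_, ?_, ?_⟩, ?_, ?_, ?_⟩
  · exact Fin.cases h₀ fun i => (h i).line
  · intro i j
    cases i using Fin.cases with
    | zero =>
      cases j using Fin.cases with
      | zero => exact fun hij => absurd rfl hij
      | succ j => exact fun _ => ⟨C j, ⟨h₀C j, (h j).evalC⟩, fun P hP => h₀inter j P hP.1 hP.2⟩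
    | succ i =>
      cases j using Fin.cases with
      | zero => exact fun _ => ⟨C i, ⟨(h i).evalC, h₀C i⟩, fun P hP => h₀inter i P hP.2 hP.1⟩
      | succ j =>
        intro hij
        have hij' : i ≠ j := fun hc => hij (congrArg _ hc)
        obtain ⟨D, -, hDi, hDj, -⟩ := (h i).exists_inter hX (h j) (hd i j hij')
        exact ⟨D, ⟨hDi, hDj⟩, fun P hP =>
          (h i).inter_unique (h j) (hd i j hij') hP.1 hP.2 hDi hDj⟩
  · have key : ∀ i j P, i ≠ j → eval P e₀ = 0 → eval P (e i) = 0 → eval P (e j) ≠ 0 := by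
      intro i j P hij hP hi
      rw [h₀inter i P hP hi]
      exact hC_other i j hij
    rintro i j k hij hik hjk ⟨P, hi, hj, hk⟩
    cases i using Fin.cases with
    | zero =>
      cases j using Fin.cases with
      | zero => exact hij rfl
      | succ j =>
        cases k using Fin.cases with
        | zero => exact hik rfl
        | succ k => exact key j k P (fun hc => hjk (congrArg _ hc)) hi hj hk
    | succ i =>
      cases j using Fin.cases with
      | zero =>
        cases k using Fin.cases with
        | zero => exact hjk rfl
        | succ k => exact key i k P (fun hc => hik (congrArg _ hc)) hj hi hk
      | succ j =>
        have hij' : i ≠ j := fun hc => hij (congrArg _ hc)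
        cases k using Fin.cases with
        | zero => exact key i j P hij' hk hi hj
        | succ k =>
          exact (h i).eval_ne_zero_of_inter hX (h j) (h k) (hd i j hij')
            (hd i k fun hc => hik (congrArg _ hc)) (hd j k fun hc => hjk (congrArg _ hc)) hi hj hk
  · intro i j
    cases i using Fin.cases with
    | zero =>
      cases j using Fin.cases with
      | zero => simpa using h₀B
      | succ j => simpa [(Fin.succ_ne_zero j)] using (h j).evalB_e
    | succ i =>
      cases j using Fin.cases with
      | zero => simpa [(Fin.succ_ne_zero i).symm] using h₀A i
      | succ j =>
        by_cases hij : i = j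
        · subst hij
          simpa using (h i).evalA
        · simpa [Ne.symm hij] using ((h i).eval_other hX (h j) (hd i j hij)).1
  · rintro ⟨L, hL, hLA⟩
    let i₀ : Fin n := ⟨0, by omega⟩
    let i₁ : Fin n := ⟨1, by omega⟩
    have h01 : i₀ ≠ i₁ := by simp [i₀, i₁]
    have hLB : eval B L = 0 := by simpa using hLA 0
    have hLs : ∀ i, eval (A i) L = 0 := fun i => by simpa using hLA i.succ
    exact ((h i₀).eval_ne_zero_of_twoNode hX (h i₁) (hd i₀ i₁ h01) (hℓ i₀) hL hLB (hLs i₀)).1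
      (hLs i₁)
  · ext P
    simp only [Finset.mem_coe, Set.mem_union, Set.mem_ofPred_eq, Set.mem_range]
    constructor
    · intro hP
      by_cases hPB : P = B
      · exact .inr ⟨0, by simp [hPB]⟩
      · obtain ⟨i, hi⟩ := exists_line_eval_eq_zero hX h hd hn hP hPB
        by_cases hf : eval P (f i) = 0
        · obtain ⟨k, hk, hPk⟩ := exists_other_line hX h hd (Fintype.card_fin n) i hf
          exact .inl ⟨i.succ, k.succ, fun hc => hk (Fin.succ_injective _ hc).symm,
            by simpa using hi, by simpa using hPk⟩
        · rcases ((h i).eval_ne P hP).1 hf with rfl | rfl | rfl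
          · exact .inr ⟨i.succ, by simp⟩
          · exact absurd rfl hPB
          · exact .inl ⟨0, i.succ, (Fin.succ_ne_zero i).symm, by simpa using h₀C i,
              by simpa using hi⟩
    · rintro (⟨i, j, hij, hi, hj⟩ | ⟨i, rfl⟩)
      · cases i using Fin.cases with
        | zero =>
          cases j using Fin.cases with
          | zero => exact absurd rfl hij
          | succ j => rw [h₀inter j P hi hj]; exact (h j).memC
        | succ i =>
          cases j using Fin.cases with
          | zero => rw [h₀inter i P hj hi]; exact (h i).memC
          | succ j =>
            have hij' := hd i j fun hc => hij (congrArg _ hc)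
            obtain ⟨D, hD, hDi, hDj, -⟩ := (h i).exists_inter hX (h j) hij'
            rwa [(h i).inter_unique (h j) hij' hi hj hDi hDj]
      · cases i using Fin.cases with
        | zero => simpa using hB
        | succ i => simpa using (h i).memA

lemma extremal_of_twoNodeLines (hn : 2 ≤ n) (hX : IsGC n X) (hB : B ∈ X)
    (h : ∀ i, IsTripletFactor n X B (A i) (C i) (e i) (f i))
    (hd : ∀ i j, i ≠ j → ¬ e j ∣ e i) (hℓ : ∀ i, IsTwoNodeLineOf X (ℓ i) (A i) B) :
    (maximalLines n X).ncard = n + 1 ∧ {Z ∈ maximalLines n X | B ∉ Z}.ncard = n ∧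
      {Z ∈ maximalLines n X | B ∈ Z}.ncard = 1 ∧ IsCarnicerGasca n X := by
  have : Nonempty (Fin n) := ⟨⟨0, by omega⟩⟩
  obtain ⟨e₀, h₀, h₀B, h₀C, h₀A, h₀inter⟩ := exists_line_through_common_node hn hX hB h hd hℓ
  have havoid := ncard_maximalLines_avoiding hX.1 h hd (Fintype.card_fin n)
  have hthrough := maximalLines_through_eq_singleton hn hX.1 hB h hd hℓ h₀ h₀B h₀C h₀inter
  refine ⟨?_, havoid, by rw [hthrough, Set.ncard_singleton],
    isCarnicerGasca_of_lines hn hX.1 hB h hd hℓ h₀ h₀B h₀C h₀A h₀inter⟩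
  have hunion : maximalLines n X =
      insert (zeroSet e₀) {Z ∈ maximalLines n X | B ∉ Z} := by
    rw [← Set.singleton_union, ← hthrough]
    ext Z
    simp only [Set.mem_union, Set.mem_sep_iff]
    tauto
  have hfin : {Z ∈ maximalLines n X | B ∉ Z}.Finite :=
    Set.finite_of_ncard_pos (by omega)
  rw [hunion, Set.ncard_insert_of_notMem (fun hc => hc.2 h₀B) hfin, havoid]

end Extremal

/-- (1) an `n`-correct set (`n ≥ 2`) has at most `n` special triplets with a
fixed common node `B`; if there are exactly `n` of them then `X` has exactly `n` maximal
lines not passing through `B`.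
(2) For `n ≥ 3`, a `GC_n` set has at most `n` used `2`-node lines with a fixed common node
`B`; if there are exactly `n` such lines then `X` has exactly `n+1` maximal lines, of
which `n` do not pass through `B` and one passes through `B`, and `X` is a Carnicer–Gasca
set of degree `n`. -/
theorem count_special_triplets_and_used_two_node_lines (n : ℕ) (hn : 2 ≤ n) :
    (∀ X : Finset Pt, IsNCorrect n X → ∀ B ∈ X,
      {S : Finset Pt | ∃ A C : Pt, S = {A, B, C} ∧ IsSpecialTriplet n X A B C}.ncard ≤ n ∧
      ({S : Finset Pt | ∃ A C : Pt, S = {A, B, C} ∧ IsSpecialTriplet n X A B C}.ncard = n →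
        {Z ∈ maximalLines n X | B ∉ Z}.ncard = n)) ∧
    (3 ≤ n → ∀ X : Finset Pt, IsGC n X → ∀ B ∈ X,
      {Z : Set Pt | ∃ (ℓ : Poly2) (A C : Pt), C ∈ X ∧ IsTwoNodeLineOf X ℓ A B ∧
        Uses n X C ℓ ∧ Z = zeroSet ℓ}.ncard ≤ n ∧
      ({Z : Set Pt | ∃ (ℓ : Poly2) (A C : Pt), C ∈ X ∧ IsTwoNodeLineOf X ℓ A B ∧
          Uses n X C ℓ ∧ Z = zeroSet ℓ}.ncard = n →
        (maximalLines n X).ncard = n + 1 ∧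
        {Z ∈ maximalLines n X | B ∉ Z}.ncard = n ∧
        {Z ∈ maximalLines n X | B ∈ Z}.ncard = 1 ∧
        IsCarnicerGasca n X)) := by
  constructor
  · intro X hX B hB
    set S := {S : Finset Pt | ∃ A C : Pt, S = {A, B, C} ∧ IsSpecialTriplet n X A B C}
    have key : ∀ s : S, ∃ A C e f, s.1 = {A, B, C} ∧ IsTripletFactor n X B A C e f := by
      rintro ⟨s, A, C, rfl, hA, -, hC, hAB, hAC, hBC, q, hq, hqX⟩
      have hq0 : q ≠ 0 := by
        rintro rfl
        have : A ∈ nonzerosIn X 0 := by rw [hqX]; simp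
        simp [nonzerosIn] at this
      obtain ⟨e, f, hef⟩ := exists_isTripletFactor hn hX hA hB hC hAB hBC.symm hAC hq0 hq.1.le
        fun P hP h1 h2 h3 => by
          by_contra h0
          have : P ∈ nonzerosIn X q := mem_filter.2 ⟨hP, h0⟩
          rw [hqX] at this
          simp [h1, h2, h3] at this
      exact ⟨A, C, e, f, rfl, hef⟩
    choose A C e f hs h using key
    have hd : ∀ i j, i ≠ j → ¬ e j ∣ e i := fun i j hij =>
      (h i).not_dvd hX hB (h j) fun hc => hij (Subtype.ext ((hs i).trans (hc.trans (hs j).symm)))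
    by_cases hfin : S.Finite
    · have : Fintype S := hfin.fintype
      have hcard : S.ncard = Fintype.card S := by
        rw [← Nat.card_coe_set_eq, Nat.card_eq_fintype_card]
      rw [hcard]
      refine ⟨card_triplets_le hX h hd, fun hn' => ?_⟩
      have : Nonempty S := Fintype.card_pos_iff.1 (by omega)
      exact ncard_maximalLines_avoiding hX h hd hn'
    · rw [Set.Infinite.ncard hfin]
      exact ⟨Nat.zero_le n, fun h0 => by omega⟩
  · intro hn3 X hX B hB
    set S := {Z : Set Pt | ∃ (ℓ : Poly2) (A C : Pt), C ∈ X ∧ IsTwoNodeLineOf X ℓ A B ∧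
        Uses n X C ℓ ∧ Z = zeroSet ℓ}
    by_cases hfin : S.Finite
    swap
    · rw [Set.Infinite.ncard hfin]
      exact ⟨Nat.zero_le n, fun h0 => by omega⟩
    by_cases hcard3 : S.ncard < 3
    · exact ⟨by omega, fun h0 => by omega⟩
    have key : ∀ s : S, ∃ ℓ A C e f, s.1 = zeroSet ℓ ∧ IsTwoNodeLineOf X ℓ A B ∧
        IsTripletFactor n X B A C e f := by
      rintro ⟨s, ℓ, A, C, hC, hℓ, hu, rfl⟩
      obtain ⟨e, f, hef⟩ := hℓ.exists_isTripletFactor hn hX.1 hB hC hu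
      exact ⟨ℓ, A, C, e, f, rfl, hℓ, hef⟩
    choose ℓ A C e f hs hℓ h using key
    have hA : Function.Injective A := by
      intro i j hij
      refine Subtype.ext ?_
      rw [hs i, hs j]
      exact zeroSet_eq_of_dvd (hℓ i).1 (hℓ j).1 ((hℓ i).1.dvd_of_two (hℓ j).1.le (h i).A_ne_B
        (hℓ i).eval_left (hℓ i).eval_right (hij ▸ (hℓ j).eval_left) (hℓ j).eval_right)
    have : Fintype S := hfin.fintype
    have hcard : S.ncard = Fintype.card S := by
      rw [← Nat.card_coe_set_eq, Nat.card_eq_fintype_card]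
    have hd : ∀ i j, i ≠ j → ¬ e j ∣ e i := by
      intro i j hij
      obtain ⟨k, hk⟩ : ∃ k, k ∉ ({i, j} : Finset S) := by
        by_contra! hcon
        have := Finset.card_le_card (fun k _ => hcon k : (univ : Finset S) ⊆ {i, j})
        have := Finset.card_le_two (a := i) (b := j)
        rw [Finset.card_univ] at *
        omega
      simp only [mem_insert, mem_singleton, not_or] at hk
      exact (h i).not_dvd hX.1 hB (h j) ((h i).triplet_ne hX hB (h j) (h k) (hℓ i) (hℓ j)
        (hA.ne hij) (hA.ne (Ne.symm hk.1)) (hA.ne (Ne.symm hk.2)))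
    refine ⟨hcard ▸ card_triplets_le hX.1 h hd, fun hn' => ?_⟩
    let σ : Fin n ≃ S := (Fintype.equivFinOfCardEq (hcard.symm.trans hn')).symm
    exact extremal_of_twoNodeLines hn hX hB (fun i => h (σ i))
      (fun i j hij => hd _ _ (σ.injective.ne hij)) fun i => hℓ (σ i)
end
end

section
/- Let X be a GC₆ set having no maximal line. If there exist three 2-node lines ℓ_{A₁B}, ℓ_{A₂B}, ℓ_{A₃B} of X with a common node B, each used by some node of X (where A₁, A₂, A₃, B ∈ X), then there exist three 6-node lines of X such that no node of X lies on more than one of them (the three lines do not intersect at nodes of X). -/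
open MvPolynomial Finset
open scoped Classical BigOperators

noncomputable section

/-- A line is given by an affine equation. -/
lemma IsLine.exists_eval_eq {ℓ : Poly2} (h : IsLine ℓ) :
    ∃ a b c : ℝ, (a ≠ 0 ∨ b ≠ 0) ∧ ∀ P : Pt, eval P ℓ = a * P 0 + b * P 1 + c := by
  have hform : ℓ = C (coeff (Finsupp.single 0 1) ℓ) * X 0
      + C (coeff (Finsupp.single 1 1) ℓ) * X 1 + C (coeff 0 ℓ) := by
    ext m
    have hm0 : 1 < m 0 + m 1 → coeff m ℓ = 0 := by
      intro hm
      apply coeff_eq_zero_of_totalDegree_lt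
      rw [show ℓ.totalDegree = 1 from h]
      calc 1 < m 0 + m 1 := hm
        _ = ∑ i, m i := by simp
        _ = ∑ i ∈ m.support, m i := by
            symm
            apply Finset.sum_subset (Finset.subset_univ _)
            intro i _ hi
            simpa using hi
    have hext : ∀ m' : Fin 2 →₀ ℕ, m' = m ↔ m' 0 = m 0 ∧ m' 1 = m 1 := by
      intro m'
      rw [Finsupp.ext_iff, Fin.forall_fin_two]
    simp only [coeff_add, coeff_C_mul, coeff_X, coeff_C]
    by_cases hm : 1 < m 0 + m 1
    · have e0 : ¬Finsupp.single 0 1 = m := by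
        rintro rfl
        simp at hm
      have e1 : ¬Finsupp.single 1 1 = m := by
        rintro rfl
        simp at hm
      have e2 : ¬0 = m := by
        rintro rfl
        simp at hm
      rw [hm0 hm, if_neg e0, if_neg e1, if_neg e2]
      ring
    · have : (m 0 = 0 ∧ m 1 = 0) ∨ (m 0 = 1 ∧ m 1 = 0) ∨ (m 0 = 0 ∧ m 1 = 1) := by omega
      rcases this with ⟨h0, h1⟩ | ⟨h0, h1⟩ | ⟨h0, h1⟩
      · have : 0 = m := by simp [hext, h0, h1]
        subst this
        simp
      · have : Finsupp.single 0 1 = m := by simp [hext, h0, h1]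
        subst this
        simp [Finsupp.ext_iff, Fin.forall_fin_two]
      · have : Finsupp.single 1 1 = m := by simp [hext, h0, h1]
        subst this
        simp [Finsupp.ext_iff, Fin.forall_fin_two]
  refine ⟨coeff (Finsupp.single 0 1) ℓ, coeff (Finsupp.single 1 1) ℓ, coeff 0 ℓ, ?_,
    fun P => ?_⟩
  rotate_left
  · conv_lhs => rw [hform]
    simp
  · by_contra! hab
    rw [hab.1, hab.2] at hform
    have : ℓ.totalDegree = 0 := by
      rw [hform]
      simp
    rw [show ℓ.totalDegree = 1 from h] at this
    exact one_ne_zero this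

/-- Two lines sharing two distinct points have the same points. -/
lemma IsLine.eval_eq_zero_of_two_points {ℓ g : Poly2} (hℓ : IsLine ℓ) (hg : IsLine g)
    {P Q R : Pt} (hPQ : P ≠ Q) (hP : eval P ℓ = 0) (hQ : eval Q ℓ = 0) (hP' : eval P g = 0)
    (hQ' : eval Q g = 0) (hR : eval R ℓ = 0) : eval R g = 0 := by
  obtain ⟨a, b, c, hab, h⟩ := hℓ.exists_eval_eq
  obtain ⟨a', b', c', -, h'⟩ := hg.exists_eval_eq
  rw [h] at hP hQ hR
  rw [h'] at hP' hQ' ⊢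
  have hdet : a * b' - a' * b = 0 := by
    by_contra hdet
    apply hPQ
    have h0 : (a * b' - a' * b) * (P 0 - Q 0) = 0 := by
      linear_combination b' * (hP - hQ) - b * (hP' - hQ')
    have h1 : (a * b' - a' * b) * (P 1 - Q 1) = 0 := by
      linear_combination a * (hP' - hQ') - a' * (hP - hQ)
    rw [mul_eq_zero, or_iff_right hdet, sub_eq_zero] at h0 h1
    ext i
    fin_cases i
    · exact h0
    · exact h1
  rcases hab with ha | hb
  · apply (mul_eq_zero.mp (?_ : a * (a' * R 0 + b' * R 1 + c') = 0)).resolve_left ha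
    linear_combination a' * (hR - hP) + a * hP' + (R 1 - P 1) * hdet
  · apply (mul_eq_zero.mp (?_ : b * (a' * R 0 + b' * R 1 + c') = 0)).resolve_left hb
    linear_combination b' * (hR - hP) + b * hP' - (R 0 - P 0) * hdet

lemma exists_isLineThrough {P Q : Pt} (hPQ : P ≠ Q) : ∃ ℓ, IsLineThrough ℓ P Q := by
  set ℓ : Poly2 := C (Q 1 - P 1) * (X 0 - C (P 0)) - C (Q 0 - P 0) * (X 1 - C (P 1)) with hℓ
  have hev : ∀ R : Pt, eval R ℓ = (Q 1 - P 1) * (R 0 - P 0) - (Q 0 - P 0) * (R 1 - P 1) := by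
    intro R
    simp [hℓ]
  refine ⟨ℓ, le_antisymm ?_ ?_, ?_, ?_⟩
  · have hX : ∀ (i : Fin 2) (a b : ℝ), (C a * (X i - C b) : Poly2).totalDegree ≤ 1 := by
      intro i a b
      refine (totalDegree_mul _ _).trans ?_
      rw [totalDegree_C, zero_add]
      refine (totalDegree_sub _ _).trans ?_
      simp [totalDegree_X]
    exact (totalDegree_sub _ _).trans (max_le (hX _ _ _) (hX _ _ _))
  · rw [Nat.one_le_iff_ne_zero]
    intro h0
    rw [totalDegree_eq_zero_iff_eq_C] at h0
    have hconst : ∀ R S : Pt, eval R ℓ = eval S ℓ := by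
      intro R S
      rw [h0]
      simp
    have h1 := hconst ![P 0 + 1, P 1] P
    have h2 := hconst ![P 0, P 1 + 1] P
    rw [hev, hev] at h1 h2
    simp at h1 h2
    apply hPQ
    ext i
    fin_cases i
    · simp; linarith
    · simp; linarith
  · rw [hev]; ring
  · rw [hev]; ring

/-- If a line divides a line, they are proportional. -/
lemma IsLine.exists_eq_C_mul_of_dvd {ℓ g : Poly2} (hℓ : IsLine ℓ) (hg : IsLine g) (h : ℓ ∣ g) :
    ∃ c : ℝ, c ≠ 0 ∧ g = C c * ℓ := by
  obtain ⟨u, rfl⟩ := h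
  have hu : u ≠ 0 := by
    rintro rfl
    exact hg.ne_zero (mul_zero _)
  have := totalDegree_mul_of_isDomain hℓ.ne_zero hu
  rw [show (ℓ * u).totalDegree = 1 from hg, show ℓ.totalDegree = 1 from hℓ] at this
  have h0 : u.totalDegree = 0 := by omega
  rw [totalDegree_eq_zero_iff_eq_C] at h0
  refine ⟨coeff 0 u, ?_, ?_⟩
  · intro hc
    rw [hc, C_0] at h0
    exact hu h0
  · rw [← h0, mul_comm]

/-- A factor complementary to some lines in a product of lines is a product of the remaining
lines, up to a constant. -/
lemma exists_subset_of_prod_lines_mul_eq {ι κ : Type*} (T : Finset ι) (g : ι → Poly2)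
    (hg : ∀ i ∈ T, IsLine (g i)) (h : κ → Poly2) (r : Poly2) (S : Finset κ) (c : ℝ)
    (hh : ∀ i ∈ S, IsLine (h i)) (hc : c ≠ 0)
    (H : (∏ i ∈ T, g i) * r = C c * ∏ i ∈ S, h i) :
    ∃ S' ⊆ S, S'.card + T.card = S.card ∧ ∃ c' : ℝ, c' ≠ 0 ∧ r = C c' * ∏ i ∈ S', h i := by
  induction T using Finset.induction_on generalizing S c with
  | empty => exact ⟨S, subset_rfl, by simp, c, hc, by simpa using H⟩
  | insert t T ht ih =>
    have hgt := hg t (mem_insert_self _ _)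
    rw [prod_insert ht, mul_assoc] at H
    have hdvd : g t ∣ C c * ∏ i ∈ S, h i := ⟨_, H.symm⟩
    have hdvd' : g t ∣ ∏ i ∈ S, h i := by
      rcases hgt.prime.dvd_or_dvd hdvd with h' | h'
      · exact absurd (isUnit_of_dvd_unit h' ((IsUnit.mk0 c hc).map C)) hgt.prime.not_isUnit
      · exact h'
    obtain ⟨s, hs, hts⟩ := (hgt.prime.dvd_finsetProd_iff _).mp hdvd'
    obtain ⟨d, hd, hhd⟩ := hgt.exists_eq_C_mul_of_dvd (hh s hs) hts
    have H' : (∏ i ∈ T, g i) * r = C (c * d) * ∏ i ∈ S.erase s, h i := by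
      apply mul_left_cancel₀ hgt.ne_zero
      rw [H, ← mul_prod_erase S h hs, hhd, C_mul]
      ring
    obtain ⟨S', hS', hcard, h'⟩ := ih (fun i hi => hg i (mem_insert_of_mem hi)) (S.erase s) _
      (fun i hi => hh i (mem_of_mem_erase hi)) (mul_ne_zero hc hd) H'
    refine ⟨S', hS'.trans (erase_subset _ _), ?_, h'⟩
    rw [card_insert_of_notMem ht, ← add_assoc, hcard, card_erase_add_one hs]

/-- A nonzero polynomial of degree less than `n` misses at least three nodes. -/
lemma IsNCorrect.exists_eval_ne_zero {n : ℕ} {X : Finset Pt} (hX : IsNCorrect n X) {q : Poly2}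
    (hq : q ≠ 0) (hdeg : q.totalDegree + 1 ≤ n) {P Q : Pt} (hPQ : P ≠ Q) :
    ∃ R ∈ X, R ≠ P ∧ R ≠ Q ∧ eval R q ≠ 0 := by
  by_contra! hcon
  obtain ⟨ℓ, hℓ, hP, hQ⟩ := exists_isLineThrough hPQ
  refine mul_ne_zero hq hℓ.ne_zero (hX.2 _ ?_ fun R hR => ?_)
  · refine (totalDegree_mul _ _).trans ?_
    rwa [show ℓ.totalDegree = 1 from hℓ]
  · rw [map_mul]
    by_cases h1 : R = P
    · rw [h1, hP, mul_zero]
    by_cases h2 : R = Q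
    · rw [h2, hQ, mul_zero]
    rw [hcon R hR h1 h2, zero_mul]

/-- A nonzero polynomial of degree at most `n` vanishing at all nodes but one is proportional to
the fundamental polynomial of that node. -/
lemma IsNCorrect.eq_C_mul_of_isFund {n : ℕ} {X : Finset Pt} (hX : IsNCorrect n X) {A : Pt}
    {p q : Poly2} (hp : IsFund n X A p) (hq : q ≠ 0) (hdeg : q.totalDegree ≤ n)
    (hvan : ∀ P ∈ X, P ≠ A → eval P q = 0) : eval A q ≠ 0 ∧ q = C (eval A q) * p := by
  refine ⟨fun h0 => hq (hX.2 q hdeg fun P hP => ?_), ?_⟩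
  · by_cases hPA : P = A
    · rw [hPA, h0]
    · exact hvan P hP hPA
  · rw [← sub_eq_zero]
    refine hX.2 _ ?_ fun P hP => ?_
    · refine (totalDegree_sub _ _).trans (max_le hdeg ((totalDegree_mul _ _).trans ?_))
      rw [totalDegree_C, zero_add]
      exact hp.1
    · by_cases hPA : P = A
      · simp [hPA, hp.2.1]
      · simp [hvan P hP hPA, hp.2.2 P hP hPA]

/-- A line contains at most `n + 1` nodes of a `GC_n` set. -/
lemma IsGC.card_zerosIn_le {n : ℕ} {X : Finset Pt} (hX : IsGC n X) {ℓ : Poly2} (hℓ : IsLine ℓ) :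
    (zerosIn X ℓ).card ≤ n + 1 := by
  by_contra! hcard
  obtain ⟨A, hA⟩ : (zerosIn X ℓ).Nonempty := card_pos.mp (by omega)
  have hA' := mem_filter.mp hA
  obtain ⟨p, hp, g, hg, rfl⟩ := hX.2 A hA'.1
  have hex : ∀ P ∈ (zerosIn X ℓ).erase A, ∃ i, eval P (g i) = 0 := by
    intro P hP
    have hP' := mem_erase.mp hP
    have := hp.2.2 P (mem_filter.mp hP'.2).1 hP'.1
    rw [map_prod, prod_eq_zero_iff] at this
    obtain ⟨i, -, hi⟩ := this
    exact ⟨i, hi⟩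
  obtain ⟨P₀, hP₀⟩ : ((zerosIn X ℓ).erase A).Nonempty :=
    card_pos.mp (by rw [card_erase_of_mem hA]; omega)
  have : Nonempty (Fin n) := (hex P₀ hP₀).nonempty
  choose! f hf using hex
  obtain ⟨P, hP, Q, hQ, hPQ, hfPQ⟩ := exists_ne_map_eq_of_card_lt_of_maps_to
    (s := (zerosIn X ℓ).erase A) (t := (univ : Finset (Fin n))) (f := f)
    (by rw [card_erase_of_mem hA, card_univ, Fintype.card_fin]; omega) (fun _ _ => by simp)
  have h0 : eval A (g (f P)) = 0 :=
    hℓ.eval_eq_zero_of_two_points (hg _) hPQ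
      (mem_filter.mp (mem_erase.mp hP).2).2 (mem_filter.mp (mem_erase.mp hQ).2).2
      (hf P hP) (hfPQ ▸ hf Q hQ) hA'.2
  have h1 := hp.2.1
  rw [map_prod, prod_eq_zero (mem_univ (f P)) h0] at h1
  exact zero_ne_one h1

/-- A used `2`-node line `ℓ_{AB}` singles out, among the six lines of the fundamental polynomial
of `B`, a line whose only nodes on no other of the six lines are `A` and a third node. -/
lemma exists_private_pair {X : Finset Pt} (hX : IsNCorrect 6 X) {A B : Pt} {ℓ : Poly2}
    (h2 : IsTwoNodeLineOf X ℓ A B) (huse : ∃ C ∈ X, Uses 6 X C ℓ) {g : Fin 6 → Poly2}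
    (hg : ∀ i, IsLine (g i)) (hB : IsFund 6 X B (∏ i, g i)) :
    ∃ D ∈ X, ∃ k : Fin 6, D ≠ A ∧ D ≠ B ∧ eval A (g k) = 0 ∧ eval D (g k) = 0 ∧
      (∀ j, j ≠ k → eval A (g j) ≠ 0 ∧ eval D (g j) ≠ 0) ∧
      ∀ P ∈ X, P ≠ A → P ≠ B → P ≠ D → ∃ j, j ≠ k ∧ eval P (g j) = 0 := by
  obtain ⟨hℓ, hAB, hz⟩ := h2
  obtain ⟨D, hD, p, hp, q, rfl⟩ := huse
  have hzA : A ∈ zerosIn X ℓ := by simp [hz]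
  have hzB : B ∈ zerosIn X ℓ := by simp [hz]
  simp only [zerosIn, mem_filter] at hzA hzB
  have hpD := hp.2.1
  rw [map_mul] at hpD
  have hDℓ : eval D ℓ ≠ 0 := by
    intro h0
    simp [h0] at hpD
  have hDq : eval D q ≠ 0 := by
    intro h0
    simp [h0] at hpD
  have hDA : D ≠ A := by
    rintro rfl
    exact hDℓ hzA.2
  have hDB : D ≠ B := by
    rintro rfl
    exact hDℓ hzB.2
  have hq : q ≠ 0 := by
    rintro rfl
    simp at hDq
  have hdeg : q.totalDegree + 1 ≤ 6 := by
    have h1 := totalDegree_mul_of_isDomain hℓ.ne_zero hq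
    have h2 := hp.1
    rw [h1, show ℓ.totalDegree = 1 from hℓ] at h2
    omega
  have hvan : ∀ P ∈ X, P ≠ A → P ≠ B → P ≠ D → eval P q = 0 := by
    intro P hP hPA hPB hPD
    have h0 := hp.2.2 P hP hPD
    rw [map_mul, mul_eq_zero] at h0
    refine h0.resolve_left fun h0 => ?_
    have : P ∈ zerosIn X ℓ := mem_filter.mpr ⟨hP, h0⟩
    rw [hz] at this
    simp [hPA, hPB] at this
  have hAq : eval A q ≠ 0 := by
    obtain ⟨R, hR, hRB, hRD, hRq⟩ := hX.exists_eval_ne_zero hq hdeg hDB.symm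
    by_cases hRA : R = A
    · rwa [← hRA]
    · exact absurd (hvan R hR hRA hRB hRD) hRq
  obtain ⟨m, hm, hmA, hmD⟩ := exists_isLineThrough hDA.symm
  obtain ⟨hc, heq⟩ := hX.eq_C_mul_of_isFund (q := m * q) hB (mul_ne_zero hm.ne_zero hq)
    (by
      refine (totalDegree_mul _ _).trans ?_
      rw [show m.totalDegree = 1 from hm]
      omega)
    (by
      intro P hP hPB
      rw [map_mul]
      by_cases hPA : P = A
      · rw [hPA, hmA, zero_mul]
      by_cases hPD : P = D
      · rw [hPD, hmD, zero_mul]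
      rw [hvan P hP hPA hPB hPD, mul_zero])
  obtain ⟨S, -, hcard, c, hc0, hqS⟩ := exists_subset_of_prod_lines_mul_eq {()} (fun _ => m)
    (fun _ _ => hm) g q univ _ (fun i _ => hg i) hc (by simpa using heq)
  obtain ⟨k, hk⟩ : ∃ k, Sᶜ = {k} := by
    rw [← card_eq_one, card_compl]
    simp at hcard ⊢
    omega
  have hS : ∀ j, j ∈ S ↔ j ≠ k := by
    intro j
    rw [← not_iff_not, ← mem_compl, hk]
    simp
  have hne : ∀ P, eval P q ≠ 0 → ∀ j, j ≠ k → eval P (g j) ≠ 0 := by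
    intro P hP j hj h0
    apply hP
    rw [hqS, map_mul, map_prod, prod_eq_zero ((hS j).mpr hj) h0, mul_zero]
  have hk0 : ∀ P ∈ X, P ≠ B → eval P q ≠ 0 → eval P (g k) = 0 := by
    intro P hP hPB hPq
    have h0 := hB.2.2 P hP hPB
    rw [map_prod, prod_eq_zero_iff] at h0
    obtain ⟨j, -, hj⟩ := h0
    by_cases hjk : j = k
    · rwa [← hjk]
    · exact absurd hj (hne P hPq j hjk)
  refine ⟨D, hD, k, hDA, hDB, hk0 A hzA.1 hAB hAq, hk0 D hD hDB hDq,
    fun j hj => ⟨hne A hAq j hj, hne D hDq j hj⟩, fun P hP hPA hPB hPD => ?_⟩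
  have h0 := hvan P hP hPA hPB hPD
  rw [hqS, map_mul, eval_C, mul_eq_zero, or_iff_right hc0, map_prod, prod_eq_zero_iff] at h0
  obtain ⟨j, hj, hj0⟩ := h0
  exact ⟨j, (hS j).mp hj, hj0⟩

/-- Two lines, one passing through a point missed by the other, share at most one node. -/
lemma card_common_nodes_le_one (X : Finset Pt) {ℓ g : Poly2} (hℓ : IsLine ℓ) (hg : IsLine g)
    {A : Pt} (h0 : eval A ℓ = 0) (h1 : eval A g ≠ 0) : (zerosIn X ℓ ∩ zerosIn X g).card ≤ 1 := by
  rw [card_le_one]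
  intro P hP Q hQ
  simp only [zerosIn, mem_inter, mem_filter] at hP hQ
  by_contra hPQ
  exact h1 (hℓ.eval_eq_zero_of_two_points hg hPQ hP.1.2 hQ.1.2 hP.2.2 hQ.2.2 h0)

/-- Two lines missing the vertex `D` of an angle with points `A₁, A₂` on one side and `C₁, C₂` on
the other cannot cover these four points and a point `B` such that the lines `B A₁` and `B A₂` miss
`C₁` and `C₂`. -/
lemma not_covered_by_two_lines {a b h h' : Poly2} {A₁ A₂ C₁ C₂ B D : Pt} (ha : IsLine a)
    (hb : IsLine b) (hh : IsLine h) (hh' : IsLine h') (hA : A₁ ≠ A₂) (hC : C₁ ≠ C₂)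
    (haA₁ : eval A₁ a = 0) (haA₂ : eval A₂ a = 0) (haD : eval D a = 0)
    (hbC₁ : eval C₁ b = 0) (hbC₂ : eval C₂ b = 0) (hbD : eval D b = 0)
    (hline : ∀ m, IsLine m → eval B m = 0 → (eval A₁ m = 0 ∨ eval A₂ m = 0) →
      (eval C₁ m = 0 ∨ eval C₂ m = 0) → False)
    (hcov : ∀ P, P = A₁ ∨ P = A₂ ∨ P = C₁ ∨ P = C₂ → eval P h = 0 ∨ eval P h' = 0)
    (hD' : eval D h' ≠ 0) (hB : eval B h = 0) : False := by
  have h1 : ¬(eval A₁ h' = 0 ∧ eval A₂ h' = 0) := fun H =>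
    hD' (ha.eval_eq_zero_of_two_points hh' hA haA₁ haA₂ H.1 H.2 haD)
  have h2 : ¬(eval C₁ h' = 0 ∧ eval C₂ h' = 0) := fun H =>
    hD' (hb.eval_eq_zero_of_two_points hh' hC hbC₁ hbC₂ H.1 H.2 hbD)
  have c1 := hcov A₁ (by simp)
  have c2 := hcov A₂ (by simp)
  have c3 := hcov C₁ (by simp)
  have c4 := hcov C₂ (by simp)
  exact hline h hh hB (by tauto) (by tauto)

/-- Three distinct lines among the six lines of a fundamental polynomial, each with only two nodes
lying on no other of the six lines, leave three lines with six nodes each, disjoint at nodes. -/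
lemma exists_three_disjoint_lines {X : Finset Pt} (hX : X.card = 28) {B : Pt}
    {g : Fin 6 → Poly2} (hg : ∀ i, IsLine (g i)) (hB : IsFund 6 X B (∏ i, g i))
    (h6 : ∀ ℓ, IsLine ℓ → (zerosIn X ℓ).card ≤ 6) {A D : Fin 3 → Pt} {k : Fin 3 → Fin 6}
    (hk : Function.Injective k) (hAk : ∀ i, eval (A i) (g (k i)) = 0)
    (hAj : ∀ i j, j ≠ k i → eval (A i) (g j) ≠ 0)
    (hpriv : ∀ i, ∀ P ∈ X, P ≠ A i → P ≠ B → P ≠ D i → ∃ j, j ≠ k i ∧ eval P (g j) = 0) :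
    ∃ g : Fin 3 → Poly2, (∀ i, IsLine (g i)) ∧
      (∀ i, (zerosIn X (g i)).card = 6) ∧
      (∀ i j, i ≠ j → zeroSet (g i) ≠ zeroSet (g j)) ∧
      (∀ i j, i ≠ j → ∀ P ∈ X, ¬(eval P (g i) = 0 ∧ eval P (g j) = 0)) := by
  obtain ⟨x, y, z, hxy, hxz, hyz, hR⟩ : ∃ x y z : Fin 6, x ≠ y ∧ x ≠ z ∧ y ≠ z ∧
      (univ.image k)ᶜ = {x, y, z} := by
    rw [← card_eq_three, card_compl, card_image_of_injective _ hk]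
    simp
  set U := zerosIn X (g x) ∪ zerosIn X (g y) ∪ zerosIn X (g z) with hU
  set I : Fin 3 → Fin 3 → Finset Pt := fun i j => zerosIn X (g (k i)) ∩ zerosIn X (g (k j)) with hI
  have hIcard : ∀ i j, i ≠ j → (I i j).card ≤ 1 := fun i j hij =>
    card_common_nodes_le_one X (hg _) (hg _) (hAk i) (hAj i _ (hk.ne hij.symm))
  have hsub : X ⊆ U ∪ ((({B} ∪ ({A 0, D 0} ∪ {A 1, D 1} ∪ {A 2, D 2})) ∪
      (I 0 1 ∪ I 0 2 ∪ I 1 2))) := by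
    intro P hP
    by_cases hPU : P ∈ U
    · exact mem_union_left _ hPU
    refine mem_union_right _ ?_
    by_cases hPB : P = B
    · simp [hPB]
    have hind : ∀ j, eval P (g j) = 0 → ∃ i, k i = j := by
      intro j hj
      by_contra hcon
      have : j ∈ (univ.image k)ᶜ := by simpa using hcon
      rw [hR] at this
      simp only [mem_insert, mem_singleton] at this
      apply hPU
      rcases this with rfl | rfl | rfl <;> simp [hU, zerosIn, hP, hj]
    have h0 := hB.2.2 P hP hPB
    rw [map_prod, prod_eq_zero_iff] at h0
    obtain ⟨j, -, hj⟩ := h0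
    obtain ⟨i, rfl⟩ := hind j hj
    by_cases hPA : P = A i
    · fin_cases i <;> simp [hPA]
    by_cases hPD : P = D i
    · fin_cases i <;> simp [hPD]
    obtain ⟨j', hj', hj0⟩ := hpriv i P hP hPA hPB hPD
    obtain ⟨i', rfl⟩ := hind j' hj0
    have hII : ∀ a b, eval P (g (k a)) = 0 → eval P (g (k b)) = 0 → P ∈ I a b := by
      intro a b h1 h2
      simp [hI, zerosIn, hP, h1, h2]
    have hii : i ≠ i' := fun h => hj' (h ▸ rfl)
    refine mem_union_right _ ?_
    simp only [mem_union]
    fin_cases i <;> fin_cases i' <;> first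
      | exact absurd rfl hii
      | exact Or.inl (Or.inl (hII _ _ hj hj0))
      | exact Or.inl (Or.inl (hII _ _ hj0 hj))
      | exact Or.inl (Or.inr (hII _ _ hj hj0))
      | exact Or.inl (Or.inr (hII _ _ hj0 hj))
      | exact Or.inr (hII _ _ hj hj0)
      | exact Or.inr (hII _ _ hj0 hj)
  have hcard : 18 ≤ U.card := by
    have h := card_le_card hsub
    rw [hX] at h
    have hV := card_union_le U ((({B} ∪ ({A 0, D 0} ∪ {A 1, D 1} ∪ {A 2, D 2})) ∪
      (I 0 1 ∪ I 0 2 ∪ I 1 2)))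
    have h1 := card_union_le ({B} ∪ ({A 0, D 0} ∪ {A 1, D 1} ∪ {A 2, D 2}) : Finset Pt)
      (I 0 1 ∪ I 0 2 ∪ I 1 2)
    have h2 := card_union_le ({B} : Finset Pt) ({A 0, D 0} ∪ {A 1, D 1} ∪ {A 2, D 2})
    have h3 := card_union_le ({A 0, D 0} ∪ {A 1, D 1} : Finset Pt) {A 2, D 2}
    have h4 := card_union_le ({A 0, D 0} : Finset Pt) {A 1, D 1}
    have h5 := card_union_le (I 0 1 ∪ I 0 2) (I 1 2)
    have h6 := card_union_le (I 0 1) (I 0 2)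
    have p0 := card_le_two (a := A 0) (b := D 0)
    have p1 := card_le_two (a := A 1) (b := D 1)
    have p2 := card_le_two (a := A 2) (b := D 2)
    have i1 := hIcard 0 1 (by decide)
    have i2 := hIcard 0 2 (by decide)
    have i3 := hIcard 1 2 (by decide)
    have := card_singleton B
    omega
  have hx := h6 _ (hg x)
  have hy := h6 _ (hg y)
  have hz := h6 _ (hg z)
  have u1 := card_union_add_card_inter (zerosIn X (g x) ∪ zerosIn X (g y)) (zerosIn X (g z))
  have u2 := card_union_add_card_inter (zerosIn X (g x)) (zerosIn X (g y))
  rw [← hU] at u1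
  have hxy0 : zerosIn X (g x) ∩ zerosIn X (g y) = ∅ := card_eq_zero.mp (by omega)
  have hxyz0 : (zerosIn X (g x) ∪ zerosIn X (g y)) ∩ zerosIn X (g z) = ∅ :=
    card_eq_zero.mp (by omega)
  have dxy : ∀ P ∈ X, eval P (g x) = 0 → eval P (g y) ≠ 0 := by
    intro P hP h1 h2
    have : P ∈ zerosIn X (g x) ∩ zerosIn X (g y) := by simp [zerosIn, hP, h1, h2]
    simp [hxy0] at this
  have dz : ∀ P ∈ X, eval P (g x) = 0 ∨ eval P (g y) = 0 → eval P (g z) ≠ 0 := by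
    intro P hP h1 h2
    have : P ∈ (zerosIn X (g x) ∪ zerosIn X (g y)) ∩ zerosIn X (g z) := by
      simp only [zerosIn, mem_inter, mem_union, mem_filter, hP, true_and]
      exact ⟨h1, h2⟩
    simp [hxyz0] at this
  have c6 : ∀ i, (zerosIn X (![g x, g y, g z] i)).card = 6 := by
    intro i
    fin_cases i
    · change (zerosIn X (g x)).card = 6
      omega
    · change (zerosIn X (g y)).card = 6
      omega
    · change (zerosIn X (g z)).card = 6
      omega
  have hdisj : ∀ i j, i ≠ j → ∀ P ∈ X,
      ¬(eval P (![g x, g y, g z] i) = 0 ∧ eval P (![g x, g y, g z] j) = 0) := by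
    intro i j hij P hP
    have d1 := dxy P hP
    have d2 := dz P hP
    fin_cases i <;> fin_cases j <;> simp at hij ⊢ <;> tauto
  refine ⟨![g x, g y, g z], ?_, c6, ?_, hdisj⟩
  · intro i
    fin_cases i
    exacts [hg x, hg y, hg z]
  · intro i j hij heq
    obtain ⟨P, hP⟩ : (zerosIn X (![g x, g y, g z] i)).Nonempty :=
      card_pos.mp (by rw [c6]; norm_num)
    have hP' := mem_filter.mp hP
    have : P ∈ zeroSet (![g x, g y, g z] j) := heq ▸ hP'.2
    exact hdisj i j hij P hP'.1 ⟨hP'.2, this⟩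

/-- The line of the fundamental polynomial of `B` through the two nodes `A₁, A₂` such that
`ℓ_{A₁B}` and `ℓ_{A₂B}` are `2`-node lines cannot have `A₁, A₂` as its only nodes lying on no other
of the six lines, if a further line of the six has the same property for a pair `A₃, D₃`. -/
lemma false_of_shared_private_pair {X : Finset Pt} (hGC : IsGC 6 X) {A₁ A₂ A₃ D₃ B : Pt}
    {ℓ₁ ℓ₂ : Poly2} (h₁ : IsTwoNodeLineOf X ℓ₁ A₁ B) (h₂ : IsTwoNodeLineOf X ℓ₂ A₂ B)
    (hA : A₁ ≠ A₂) (hA₃ : A₃ ∈ X) (hD₃ : D₃ ∈ X) (hAB₃ : A₃ ≠ B) (hDB₃ : D₃ ≠ B) (hAD : D₃ ≠ A₃)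
    {g : Fin 6 → Poly2} (hg : ∀ i, IsLine (g i)) (hB : IsFund 6 X B (∏ i, g i))
    {a b : Fin 6} (hab : b ≠ a)
    (hA₁a : eval A₁ (g a) = 0) (hA₂a : eval A₂ (g a) = 0)
    (hA₁ : ∀ j, j ≠ a → eval A₁ (g j) ≠ 0) (hA₂ : ∀ j, j ≠ a → eval A₂ (g j) ≠ 0)
    (hA₃b : eval A₃ (g b) = 0) (hD₃b : eval D₃ (g b) = 0)
    (hA₃j : ∀ j, j ≠ b → eval A₃ (g j) ≠ 0) (hD₃j : ∀ j, j ≠ b → eval D₃ (g j) ≠ 0)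
    (hpa : ∀ P ∈ X, P ≠ A₁ → P ≠ B → P ≠ A₂ → ∃ j, j ≠ a ∧ eval P (g j) = 0)
    (hpb : ∀ P ∈ X, P ≠ A₃ → P ≠ B → P ≠ D₃ → ∃ j, j ≠ b ∧ eval P (g j) = 0) : False := by
  have hX := hGC.1
  have n13 : A₃ ≠ A₁ := by
    rintro rfl
    exact hA₁ b hab hA₃b
  have n1D : D₃ ≠ A₁ := by
    rintro rfl
    exact hA₁ b hab hD₃b
  have n23 : A₃ ≠ A₂ := by
    rintro rfl
    exact hA₂ b hab hA₃b
  have n2D : D₃ ≠ A₂ := by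
    rintro rfl
    exact hA₂ b hab hD₃b
  set T : Finset (Fin 6) := (univ.erase a).erase b with hT
  have hTmem : ∀ j, j ∈ T ↔ j ≠ b ∧ j ≠ a := by simp [hT]
  have hTcard : T.card = 4 := by
    rw [hT, card_erase_of_mem (by simp [hab]), card_erase_of_mem (mem_univ _)]
    simp
  set M : Poly2 := ∏ i ∈ T, g i with hM
  have hM0 : M ≠ 0 := prod_ne_zero_iff.mpr fun i _ => (hg i).ne_zero
  have hMzero : ∀ P, (∃ j, j ≠ b ∧ j ≠ a ∧ eval P (g j) = 0) → eval P M = 0 := by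
    rintro P ⟨j, h1, h2, h3⟩
    rw [hM, map_prod]
    exact prod_eq_zero ((hTmem j).mpr ⟨h1, h2⟩) h3
  have hMdeg : M.totalDegree ≤ 4 := by
    refine (totalDegree_finsetProd T g).trans ?_
    rw [sum_congr rfl (fun i _ => (hg i : (g i).totalDegree = 1)), sum_const, hTcard]
    norm_num
  have hgB : ∀ j, eval B (g j) ≠ 0 := by
    intro j hj
    have h1 := hB.2.1
    rw [map_prod, prod_eq_zero (mem_univ j) hj] at h1
    exact zero_ne_one h1
  obtain ⟨m, hm, hm1, hm3⟩ := exists_isLineThrough n13.symm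
  obtain ⟨m', hm', hm'2, hm'D⟩ := exists_isLineThrough n2D.symm
  -- a conic through `A₁`, `A₂`, `A₃`, `D₃` and `B`
  set t : ℝ := eval B m * eval B m' / (eval B (g a) * eval B (g b)) with ht
  set r : Poly2 := m * m' - C t * (g a * g b) with hr
  have hreval : ∀ P, eval P r = eval P m * eval P m' - t * (eval P (g a) * eval P (g b)) := by
    intro P
    simp [hr]
  have hr1 : eval A₁ r = 0 := by simp [hreval, hm1, hA₁a]
  have hr2 : eval A₂ r = 0 := by simp [hreval, hm'2, hA₂a]
  have hr3 : eval A₃ r = 0 := by simp [hreval, hm3, hA₃b]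
  have hrD : eval D₃ r = 0 := by simp [hreval, hm'D, hD₃b]
  have hrB : eval B r = 0 := by
    rw [hreval, ht, div_mul_cancel₀ _ (mul_ne_zero (hgB a) (hgB b)), sub_self]
  have hr0 : r ≠ 0 := by
    intro h0
    have hdvd : g a ∣ m * m' := ⟨C t * g b, by
      rw [hr, sub_eq_zero] at h0
      rw [h0]
      ring⟩
    rcases (hg a).prime.dvd_or_dvd hdvd with h | h
    · obtain ⟨c, hc, rfl⟩ := (hg a).exists_eq_C_mul_of_dvd hm h
      rw [map_mul, eval_C, mul_eq_zero, or_iff_right hc] at hm3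
      exact hA₃j a hab.symm hm3
    · obtain ⟨c, hc, rfl⟩ := (hg a).exists_eq_C_mul_of_dvd hm' h
      rw [map_mul, eval_C, mul_eq_zero, or_iff_right hc] at hm'D
      exact hD₃j a hab.symm hm'D
  have hrdeg : r.totalDegree ≤ 2 := by
    have h2 : ∀ p q : Poly2, IsLine p → IsLine q → (p * q).totalDegree ≤ 2 := by
      intro p q hp hq
      refine (totalDegree_mul _ _).trans ?_
      rw [show p.totalDegree = 1 from hp, show q.totalDegree = 1 from hq]
    refine (totalDegree_sub _ _).trans (max_le (h2 _ _ hm hm') ((totalDegree_mul _ _).trans ?_))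
    rw [totalDegree_C, zero_add]
    exact h2 _ _ (hg a) (hg b)
  have hMr0 : M * r ≠ 0 := mul_ne_zero hM0 hr0
  have hMrdeg : (M * r).totalDegree ≤ 6 := (totalDegree_mul _ _).trans (by omega)
  obtain ⟨D, hDX, hDMr⟩ : ∃ D ∈ X, eval D (M * r) ≠ 0 := by
    by_contra! hcon
    exact hMr0 (hX.2 _ hMrdeg hcon)
  have hlie : ∀ P ∈ X, eval P (M * r) ≠ 0 → eval P (g a) = 0 ∧ eval P (g b) = 0 := by
    intro P hP hPMr
    rw [map_mul, mul_ne_zero_iff] at hPMr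
    have e1 : P ≠ A₁ := by rintro rfl; exact hPMr.2 hr1
    have e2 : P ≠ A₂ := by rintro rfl; exact hPMr.2 hr2
    have e3 : P ≠ A₃ := by rintro rfl; exact hPMr.2 hr3
    have e4 : P ≠ D₃ := by rintro rfl; exact hPMr.2 hrD
    have e5 : P ≠ B := by rintro rfl; exact hPMr.2 hrB
    obtain ⟨j, hj, hj0⟩ := hpa P hP e1 e5 e2
    obtain ⟨j', hj', hj0'⟩ := hpb P hP e3 e5 e4
    have hjb : j = b := by
      by_contra h
      exact hPMr.1 (hMzero P ⟨j, h, hj, hj0⟩)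
    have hja : j' = a := by
      by_contra h
      exact hPMr.1 (hMzero P ⟨j', hj', h, hj0'⟩)
    subst hjb hja
    exact ⟨hj0', hj0⟩
  obtain ⟨hDa, hDb⟩ := hlie D hDX hDMr
  obtain ⟨p, hp, h, hh, rfl⟩ := hGC.2 D hDX
  obtain ⟨hc, heq⟩ := hX.eq_C_mul_of_isFund hp hMr0 hMrdeg (by
    intro P hP hPD
    by_contra hne
    obtain ⟨hPa, hPb⟩ := hlie P hP hne
    exact hA₁ b hab
      ((hg a).eval_eq_zero_of_two_points (hg b) hPD hPa hDa hPb hDb hA₁a))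
  obtain ⟨S, -, hScard, c, hc0, hrS⟩ := exists_subset_of_prod_lines_mul_eq T g
    (fun i _ => hg i) h r univ _ (fun i _ => hh i) hc heq
  rw [hTcard, card_univ, Fintype.card_fin] at hScard
  obtain ⟨u, v, huv, rfl⟩ := card_eq_two.mp (show S.card = 2 by omega)
  rw [prod_pair huv] at hrS
  have hcov : ∀ P, eval P r = 0 → eval P (h u) = 0 ∨ eval P (h v) = 0 := by
    intro P hP
    rwa [hrS, map_mul, map_mul, eval_C, mul_eq_zero, or_iff_right hc0, mul_eq_zero] at hP
  have hDh : ∀ j, eval D (h j) ≠ 0 := by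
    intro j hj
    have h1 := hp.2.1
    rw [map_prod, prod_eq_zero (mem_univ j) hj] at h1
    exact zero_ne_one h1
  have htwo : ∀ {A : Pt} {ℓ : Poly2}, IsTwoNodeLineOf X ℓ A B → ∀ m, IsLine m → eval B m = 0 →
      eval A m = 0 → ∀ P ∈ X, eval P m = 0 → P = A ∨ P = B := by
    rintro A ℓ ⟨hℓ, hAB, hz⟩ m hm hmB hmA P hP hmP
    have hzA : A ∈ zerosIn X ℓ := by simp [hz]
    have hzB : B ∈ zerosIn X ℓ := by simp [hz]
    have hzP : P ∈ zerosIn X ℓ := mem_filter.mpr ⟨hP, hm.eval_eq_zero_of_two_points hℓ hAB hmA hmB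
      (mem_filter.mp hzA).2 (mem_filter.mp hzB).2 hmP⟩
    simpa [hz] using hzP
  have hline : ∀ m, IsLine m → eval B m = 0 → (eval A₁ m = 0 ∨ eval A₂ m = 0) →
      (eval A₃ m = 0 ∨ eval D₃ m = 0) → False := by
    rintro m hm hmB (h0 | h0) (h3 | h3)
    · exact (htwo h₁ m hm hmB h0 A₃ hA₃ h3).elim n13 hAB₃
    · exact (htwo h₁ m hm hmB h0 D₃ hD₃ h3).elim n1D hDB₃
    · exact (htwo h₂ m hm hmB h0 A₃ hA₃ h3).elim n23 hAB₃
    · exact (htwo h₂ m hm hmB h0 D₃ hD₃ h3).elim n2D hDB₃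
  have hcov' : ∀ P, P = A₁ ∨ P = A₂ ∨ P = A₃ ∨ P = D₃ →
      eval P (h u) = 0 ∨ eval P (h v) = 0 := by
    rintro P (rfl | rfl | rfl | rfl) <;> apply hcov <;> assumption
  rcases hcov B hrB with hu | hv
  · exact not_covered_by_two_lines (hg a) (hg b) (hh u) (hh v) hA hAD.symm hA₁a hA₂a hDa hA₃b
      hD₃b hDb hline hcov' (hDh v) hu
  · exact not_covered_by_two_lines (hg a) (hg b) (hh v) (hh u) hA hAD.symm hA₁a hA₂a hDa hA₃b
      hD₃b hDb hline (fun P hP => (hcov' P hP).symm) (hDh u) hv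

/-- Corollary on `GC₆` sets: if a `GC₆` set `X` has no maximal
(`7`-node) line and there are three `2`-node lines `ℓ_{A₁B}, ℓ_{A₂B}, ℓ_{A₃B}` with a
common node `B`, each used by some node of `X`, then there are three `6`-node lines of
`X` no two of which intersect at a node of `X`. -/
theorem gc6_three_six_node_lines (X : Finset Pt) (hGC : IsGC 6 X)
    (hnomax : ∀ ℓ : Poly2, IsLine ℓ → (zerosIn X ℓ).card ≠ 7)
    (A : Fin 3 → Pt) (B : Pt) (ℓ : Fin 3 → Poly2)
    (hdistinct : ∀ i j, i ≠ j → A i ≠ A j)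
    (h2 : ∀ i, IsTwoNodeLineOf X (ℓ i) (A i) B)
    (huse : ∀ i, ∃ C ∈ X, Uses 6 X C (ℓ i)) :
    ∃ g : Fin 3 → Poly2, (∀ i, IsLine (g i)) ∧
      (∀ i, (zerosIn X (g i)).card = 6) ∧
      (∀ i j, i ≠ j → zeroSet (g i) ≠ zeroSet (g j)) ∧
      (∀ i j, i ≠ j → ∀ P ∈ X, ¬(eval P (g i) = 0 ∧ eval P (g j) = 0)) := by
  have hX := hGC.1
  have hzA : ∀ i, A i ∈ X := fun i => (mem_filter.mp
    (show A i ∈ zerosIn X (ℓ i) by simp [(h2 i).2.2])).1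
  have hB_mem : B ∈ X := (mem_filter.mp
    (show B ∈ zerosIn X (ℓ 0) by simp [(h2 0).2.2])).1
  have h6 : ∀ ℓ, IsLine ℓ → (zerosIn X ℓ).card ≤ 6 := by
    intro ℓ hℓ
    have h1 := hGC.card_zerosIn_le hℓ
    have h2 := hnomax ℓ hℓ
    omega
  obtain ⟨p, hB, g, hg, rfl⟩ := hGC.2 B hB_mem
  choose D hDX k hDA hDB hAk hDk hne hpriv using
    fun i => exists_private_pair hX (h2 i) (huse i) hg hB
  refine exists_three_disjoint_lines hX.1 hg hB h6 (fun i j hij => ?_) hAk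
    (fun i j hj => (hne i j hj).1) hpriv
  by_contra hne_ij
  have hshare : ∀ j, j ≠ i → k j = k i → A j = D i := by
    intro j hji hkj
    by_contra hcon
    obtain ⟨l, hl, hl0⟩ := hpriv i (A j) (hzA j) (hdistinct j i hji) (h2 j).2.1 hcon
    exact (hne j l (hkj ▸ hl)).1 hl0
  have hAD := hshare j (Ne.symm hne_ij) hij.symm
  obtain ⟨l, hli, hlj⟩ := (by decide : ∀ i j : Fin 3, ∃ l, l ≠ i ∧ l ≠ j) i j
  have hkl : k l ≠ k i := fun h =>
    hdistinct l j hlj ((hshare l hli h).trans hAD.symm)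
  exact false_of_shared_private_pair hGC (h2 i) (h2 j) (hdistinct i j hne_ij) (hzA l) (hDX l)
    (h2 l).2.1 (hDB l) (hDA l) hg hB hkl (hAk i) (hij ▸ hAk j) (fun m hm => (hne i m hm).1)
    (fun m hm => (hne j m (hij ▸ hm)).1) (hAk l) (hDk l) (fun m hm => (hne l m hm).1)
    (fun m hm => (hne l m hm).2) (hAD ▸ hpriv i) (hpriv l)
end
end
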